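/- arXiv:2406.12457 — 18 statements merged into one kernel-verified Lean document; each statement's English description precedes it below -/
import Mathlib

section
/- Let μ0 ∈ (0,1) and 0 < v_L < v_H. Let S be a finite set and πH, πL : S → ℝ nonnegative functions with ∑_{s∈S} πH(s) = ∑_{s∈S} πL(s) = 1. For each s ∈ S let w(s) := μ0·πH(s) + (1−μ0)·πL(s), and for s with w(s) > 0 let μ(s) := μ0·πH(s)/w(s). Let ℓ := {s ∈ S : w(s) > 0 and μ(s) < v_L/v_H} and let h := S ∖ ℓ. Define the merged weights ŵ(ℓ) := ∑_{s∈ℓ} w(s), ŵ(h) := ∑_{s∈h} w(s) and merged posteriors μ̂(ℓ) := μ0·∑_{s∈ℓ} πH(s) / ŵ(ℓ) (when ŵ(ℓ) > 0) and μ̂(h) := μ0·∑_{s∈h} πH(s) / ŵ(h) (when ŵ(h) > 0). Then: (i) if ŵ(ℓ) > 0 then μ̂(ℓ) ≤ v_L/v_H, and if ŵ(h) > 0 then μ̂(h) ≥ v_L/v_H (obedience of the merged binary signal); and (ii) the producer's expected revenue is preserved: ∑_{s : w(s)>0} w(s)·max(v_H·μ(s), v_L) = ŵ(ℓ)·v_L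 + v_H·μ0·∑_{s∈h} πH(s), where the right-hand side equals ŵ(ℓ)·max(v_H·μ̂(ℓ), v_L) + ŵ(h)·max(v_H·μ̂(h), v_L) with any zero-weight term taken to be 0. -/
noncomputable section

/-- Total weight of signal `s`. -/
def wgt {S : Type*} (μ0 : ℝ) (πH πL : S → ℝ) (s : S) : ℝ :=
  μ0 * πH s + (1 - μ0) * πL s

/-- Posterior probability of the high type after signal `s`. -/
def post {S : Type*} (μ0 : ℝ) (πH πL : S → ℝ) (s : S) : ℝ :=
  μ0 * πH s / wgt μ0 πH πL s

open Classical in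
/-- The set of signals with positive weight and posterior below `vL / vH`. -/
def lowSig {S : Type*} [Fintype S] (μ0 vL vH : ℝ) (πH πL : S → ℝ) : Finset S :=
  Finset.univ.filter (fun s => 0 < wgt μ0 πH πL s ∧ post μ0 πH πL s < vL / vH)

theorem wgt_nonneg {S : Type*} {μ0 : ℝ} (hμ : μ0 ∈ Set.Icc (0 : ℝ) 1) {πH πL : S → ℝ}
    {s : S} (hH : 0 ≤ πH s) (hL : 0 ≤ πL s) : 0 ≤ wgt μ0 πH πL s :=
  add_nonneg (mul_nonneg hμ.1 hH) (mul_nonneg (sub_nonneg.2 hμ.2) hL)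

theorem mul_le_wgt {S : Type*} {μ0 : ℝ} (hμ : μ0 ≤ 1) {πH πL : S → ℝ}
    {s : S} (hL : 0 ≤ πL s) : μ0 * πH s ≤ wgt μ0 πH πL s :=
  le_add_of_nonneg_right (mul_nonneg (sub_nonneg.2 hμ) hL)

theorem mul_max_div {w a v c : ℝ} (hw : 0 < w) :
    w * max (v * (a / w)) c = max (v * a) (w * c) := by
  rw [mul_max_of_nonneg _ _ hw.le]
  congr 1
  field_simp

theorem mul_max_div_of_le {w a v c : ℝ} (hw : 0 ≤ w) (h : v * a ≤ w * c) :
    w * max (v * (a / w)) c = w * c := by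
  rcases hw.eq_or_lt with rfl | hw
  · simp
  · rw [mul_max_div hw, max_eq_right h]

theorem mul_max_div_of_ge {w a v c : ℝ} (hw : 0 ≤ w) (ha : w = 0 → a = 0)
    (h : w * c ≤ v * a) : w * max (v * (a / w)) c = v * a := by
  rcases hw.eq_or_lt with rfl | hw
  · simp [ha rfl]
  · rw [mul_max_div hw, max_eq_left h]

open Classical in
theorem stmt0 {S : Type*} [Fintype S] (μ0 vL vH : ℝ)
    (hμ : μ0 ∈ Set.Ioo (0:ℝ) 1) (hvL : 0 < vL) (hv : vL < vH)
    (πH πL : S → ℝ) (hπH0 : ∀ s, 0 ≤ πH s) (hπL0 : ∀ s, 0 ≤ πL s)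
    (hπH1 : ∑ s, πH s = 1) (hπL1 : ∑ s, πL s = 1) :
    -- (i) obedience of the merged binary signal
    (0 < ∑ s ∈ lowSig μ0 vL vH πH πL, wgt μ0 πH πL s →
      μ0 * (∑ s ∈ lowSig μ0 vL vH πH πL, πH s) /
        (∑ s ∈ lowSig μ0 vL vH πH πL, wgt μ0 πH πL s) ≤ vL / vH) ∧
    (0 < ∑ s ∈ (lowSig μ0 vL vH πH πL)ᶜ, wgt μ0 πH πL s →
      μ0 * (∑ s ∈ (lowSig μ0 vL vH πH πL)ᶜ, πH s) /
        (∑ s ∈ (lowSig μ0 vL vH πH πL)ᶜ, wgt μ0 πH πL s) ≥ vL / vH) ∧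
    -- (ii) expected revenue is preserved by merging
    (∑ s ∈ Finset.univ.filter (fun s => 0 < wgt μ0 πH πL s),
        wgt μ0 πH πL s * max (vH * post μ0 πH πL s) vL
      = (∑ s ∈ lowSig μ0 vL vH πH πL, wgt μ0 πH πL s) * vL
        + vH * μ0 * ∑ s ∈ (lowSig μ0 vL vH πH πL)ᶜ, πH s) ∧
    ((∑ s ∈ lowSig μ0 vL vH πH πL, wgt μ0 πH πL s) * vL
        + vH * μ0 * ∑ s ∈ (lowSig μ0 vL vH πH πL)ᶜ, πH s
      = (∑ s ∈ lowSig μ0 vL vH πH πL, wgt μ0 πH πL s) *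
          max (vH * (μ0 * (∑ s ∈ lowSig μ0 vL vH πH πL, πH s) /
            (∑ s ∈ lowSig μ0 vL vH πH πL, wgt μ0 πH πL s))) vL
        + (∑ s ∈ (lowSig μ0 vL vH πH πL)ᶜ, wgt μ0 πH πL s) *
          max (vH * (μ0 * (∑ s ∈ (lowSig μ0 vL vH πH πL)ᶜ, πH s) /
            (∑ s ∈ (lowSig μ0 vL vH πH πL)ᶜ, wgt μ0 πH πL s))) vL) := by
  have hvH : 0 < vH := hvL.trans hv
  have hw (s : S) : 0 ≤ wgt μ0 πH πL s :=
    wgt_nonneg (Set.Ioo_subset_Icc_self hμ) (hπH0 s) (hπL0 s)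
  have ha (s : S) : 0 ≤ μ0 * πH s := mul_nonneg hμ.1.le (hπH0 s)
  have haw (s : S) : μ0 * πH s ≤ wgt μ0 πH πL s := mul_le_wgt hμ.2.le (hπL0 s)
  have ha0 (s : S) (h : wgt μ0 πH πL s = 0) : μ0 * πH s = 0 :=
    le_antisymm ((haw s).trans_eq h) (ha s)
  have hlow (s : S) (hs : s ∈ lowSig μ0 vL vH πH πL) :
      vH * (μ0 * πH s) ≤ wgt μ0 πH πL s * vL := by
    obtain ⟨h0, h1⟩ := (Finset.mem_filter.1 hs).2
    rw [post, div_lt_div_iff₀ h0 hvH] at h1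
    linarith
  have hhigh (s : S) (hs : s ∈ (lowSig μ0 vL vH πH πL)ᶜ) :
      wgt μ0 πH πL s * vL ≤ vH * (μ0 * πH s) := by
    rcases (hw s).eq_or_lt with h0 | h0
    · rw [← h0, zero_mul]
      exact mul_nonneg hvH.le (ha s)
    · have h1 : vL / vH ≤ post μ0 πH πL s := by
        by_contra! h1
        exact Finset.mem_compl.1 hs (Finset.mem_filter.2 ⟨Finset.mem_univ s, h0, h1⟩)
      rw [post, div_le_div_iff₀ hvH h0] at h1
      linarith
  set A := lowSig μ0 vL vH πH πL
  have hA : vH * (μ0 * ∑ s ∈ A, πH s) ≤ (∑ s ∈ A, wgt μ0 πH πL s) * vL := by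
    rw [Finset.mul_sum, Finset.mul_sum, Finset.sum_mul]
    exact Finset.sum_le_sum hlow
  have hAc : (∑ s ∈ Aᶜ, wgt μ0 πH πL s) * vL ≤ vH * (μ0 * ∑ s ∈ Aᶜ, πH s) := by
    rw [Finset.mul_sum, Finset.mul_sum, Finset.sum_mul]
    exact Finset.sum_le_sum hhigh
  refine ⟨fun h => ?_, fun h => ?_, ?_, ?_⟩
  · rw [div_le_div_iff₀ h hvH]
    linarith
  · rw [ge_iff_le, div_le_div_iff₀ hvH h]
    linarith
  · rw [Finset.sum_filter_of_ne fun s _ h => (hw s).lt_of_ne' (left_ne_zero_of_mul h),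
      ← Finset.sum_add_sum_compl A, Finset.sum_mul, mul_assoc, Finset.mul_sum, Finset.mul_sum]
    exact congrArg₂ _
      (Finset.sum_congr rfl fun s hs => mul_max_div_of_le (hw s) (hlow s hs))
      (Finset.sum_congr rfl fun s hs => mul_max_div_of_ge (hw s) (ha0 s) (hhigh s hs))
  · rw [mul_max_div_of_le (Finset.sum_nonneg fun s _ => hw s) hA,
      mul_max_div_of_ge (Finset.sum_nonneg fun s _ => hw s) ?_ hAc, mul_assoc]
    intro h
    rw [Finset.mul_sum]
    exact Finset.sum_eq_zero fun s hs =>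
      ha0 s ((Finset.sum_eq_zero_iff_of_nonneg fun s _ => hw s).1 h s hs)
end
end

section
/- Fix reals L, H with δ := H − L > 0, reals 0 < v_L < v_H with Δv := v_H − v_L, μ0 ∈ (0,1), and a real V. If μ0 > v_L/v_H, then every maximizer of the large-prior objective Φ over the large-prior feasible set F⁺ satisfies x_H ≥ H and x_L ≤ L. Likewise, if μ0 < v_L/v_H, then every maximizer of the small-prior objective Ψ over the small-prior feasible set F⁻ satisfies x_H ≥ H and x_L ≤ L. -/
/-- A mechanism: service provisions `xH, xL`, fees `fH, fL`,
and disclosure probabilities `piL, piH` of the low-price signal. -/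
structure Mech where
  xH : ℝ
  xL : ℝ
  fH : ℝ
  fL : ℝ
  piL : ℝ
  piH : ℝ

/-- Large-prior feasible set F⁺. -/
def FeasPlus (L H vL vH μ0 V : ℝ) (m : Mech) : Prop :=
  0 ≤ m.piL ∧ m.piL ≤ 1 ∧ 0 ≤ m.piH ∧ m.piH ≤ 1 ∧
  (-(m.xH - H)^2 - m.fH + m.piH * (vH - vL) ≥ -(m.xL - H)^2 - m.fL + m.piL * (vH - vL)) ∧
  (-(m.xL - L)^2 - m.fL ≥ -(m.xH - L)^2 - m.fH) ∧
  (V - (m.xH - H)^2 - m.fH + m.piH * (vH - vL) ≥ 0) ∧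
  (V - (m.xL - L)^2 - m.fL ≥ 0) ∧
  ((1 - vL / vH) * μ0 * m.piH ≤ (vL / vH) * (1 - μ0) * m.piL)

/-- Large-prior objective Φ. -/
noncomputable def Phi (vL vH μ0 : ℝ) (m : Mech) : ℝ :=
  μ0 * m.fH + (1 - μ0) * m.fL - μ0 * m.piH * (vH - vL) + (1 - μ0) * m.piL * vL

/-- Small-prior feasible set F⁻. -/
def FeasMinus (L H vL vH μ0 V : ℝ) (m : Mech) : Prop :=
  0 ≤ m.piL ∧ m.piL ≤ 1 ∧ 0 ≤ m.piH ∧ m.piH ≤ 1 ∧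
  (-(m.xH - H)^2 - m.fH + m.piH * (vH - vL) ≥ -(m.xL - H)^2 - m.fL + m.piL * (vH - vL)) ∧
  (-(m.xL - L)^2 - m.fL ≥ -(m.xH - L)^2 - m.fH) ∧
  (V - (m.xH - H)^2 - m.fH + m.piH * (vH - vL) ≥ vH - vL) ∧
  (V - (m.xL - L)^2 - m.fL ≥ 0) ∧
  ((vL / vH) * (1 - μ0) * m.piL - (1 - vL / vH) * μ0 * m.piH ≥ vL / vH - μ0)

/-- Small-prior objective Ψ. -/
noncomputable def Psi (vL vH μ0 : ℝ) (m : Mech) : ℝ :=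
  μ0 * m.fH + (1 - μ0) * m.fL + (1 - μ0) * m.piL * vL - μ0 * m.piH * (vH - vL) + μ0 * vH - vL

/-- `m` maximizes `f` over `F`. -/
def IsMaximizer {α : Type*} (F : Set α) (f : α → ℝ) (m : α) : Prop :=
  m ∈ F ∧ ∀ m' ∈ F, f m' ≤ f m

/-- Moving the provision for `H` to its efficient level while holding the type's utility fixed. -/
def Mech.efficientH (m : Mech) (H : ℝ) : Mech :=
  { m with xH := H, fH := m.fH + (m.xH - H)^2 }

/-- Moving the provision for `L` to its efficient level while holding the type's utility fixed. -/
def Mech.efficientL (m : Mech) (L : ℝ) : Mech :=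
  { m with xL := L, fL := m.fL + (m.xL - L)^2 }

theorem FeasPlus.efficientH {L H vL vH μ0 V : ℝ} {m : Mech} (hLH : L < H) (hx : m.xH < H)
    (h : FeasPlus L H vL vH μ0 V m) : FeasPlus L H vL vH μ0 V (m.efficientH H) := by
  obtain ⟨h₁, h₂, h₃, h₄, icH, icL, irH, irL, ob⟩ := h
  have := mul_nonneg (sub_nonneg.2 hLH.le) (sub_nonneg.2 hx.le)
  refine ⟨h₁, h₂, h₃, h₄, ?_, ?_, ?_, ?_, ob⟩ <;> dsimp only [Mech.efficientH] <;> linarith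

theorem FeasPlus.efficientL {L H vL vH μ0 V : ℝ} {m : Mech} (hLH : L < H) (hx : L < m.xL)
    (h : FeasPlus L H vL vH μ0 V m) : FeasPlus L H vL vH μ0 V (m.efficientL L) := by
  obtain ⟨h₁, h₂, h₃, h₄, icH, icL, irH, irL, ob⟩ := h
  have := mul_nonneg (sub_nonneg.2 hLH.le) (sub_nonneg.2 hx.le)
  refine ⟨h₁, h₂, h₃, h₄, ?_, ?_, ?_, ?_, ob⟩ <;> dsimp only [Mech.efficientL] <;> linarith

theorem FeasMinus.efficientH {L H vL vH μ0 V : ℝ} {m : Mech} (hLH : L < H) (hx : m.xH < H)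
    (h : FeasMinus L H vL vH μ0 V m) : FeasMinus L H vL vH μ0 V (m.efficientH H) := by
  obtain ⟨h₁, h₂, h₃, h₄, icH, icL, irH, irL, ob⟩ := h
  have := mul_nonneg (sub_nonneg.2 hLH.le) (sub_nonneg.2 hx.le)
  refine ⟨h₁, h₂, h₃, h₄, ?_, ?_, ?_, ?_, ob⟩ <;> dsimp only [Mech.efficientH] <;> linarith

theorem FeasMinus.efficientL {L H vL vH μ0 V : ℝ} {m : Mech} (hLH : L < H) (hx : L < m.xL)
    (h : FeasMinus L H vL vH μ0 V m) : FeasMinus L H vL vH μ0 V (m.efficientL L) := by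
  obtain ⟨h₁, h₂, h₃, h₄, icH, icL, irH, irL, ob⟩ := h
  have := mul_nonneg (sub_nonneg.2 hLH.le) (sub_nonneg.2 hx.le)
  refine ⟨h₁, h₂, h₃, h₄, ?_, ?_, ?_, ?_, ob⟩ <;> dsimp only [Mech.efficientL] <;> linarith

theorem Phi_lt_efficientH {H vL vH μ0 : ℝ} {m : Mech} (hμ : μ0 ∈ Set.Ioo (0:ℝ) 1)
    (hx : m.xH < H) : Phi vL vH μ0 m < Phi vL vH μ0 (m.efficientH H) := by
  have := mul_pos hμ.1 (sq_pos_iff.2 (sub_neg.2 hx).ne)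
  dsimp only [Phi, Mech.efficientH]
  linarith

theorem Phi_lt_efficientL {L vL vH μ0 : ℝ} {m : Mech} (hμ : μ0 ∈ Set.Ioo (0:ℝ) 1)
    (hx : L < m.xL) : Phi vL vH μ0 m < Phi vL vH μ0 (m.efficientL L) := by
  have := mul_pos (sub_pos.2 hμ.2) (sq_pos_iff.2 (sub_pos.2 hx).ne')
  dsimp only [Phi, Mech.efficientL]
  linarith

theorem Psi_lt_efficientH {H vL vH μ0 : ℝ} {m : Mech} (hμ : μ0 ∈ Set.Ioo (0:ℝ) 1)
    (hx : m.xH < H) : Psi vL vH μ0 m < Psi vL vH μ0 (m.efficientH H) := by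
  have := mul_pos hμ.1 (sq_pos_iff.2 (sub_neg.2 hx).ne)
  dsimp only [Psi, Mech.efficientH]
  linarith

theorem Psi_lt_efficientL {L vL vH μ0 : ℝ} {m : Mech} (hμ : μ0 ∈ Set.Ioo (0:ℝ) 1)
    (hx : L < m.xL) : Psi vL vH μ0 m < Psi vL vH μ0 (m.efficientL L) := by
  have := mul_pos (sub_pos.2 hμ.2) (sq_pos_iff.2 (sub_pos.2 hx).ne')
  dsimp only [Psi, Mech.efficientL]
  linarith

theorem stmt1 (L H vL vH μ0 V : ℝ) (hLH : L < H) (hvL : 0 < vL) (hv : vL < vH)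
    (hμ : μ0 ∈ Set.Ioo (0:ℝ) 1) :
    (μ0 > vL / vH →
      ∀ m : Mech, IsMaximizer {m' | FeasPlus L H vL vH μ0 V m'} (Phi vL vH μ0) m →
        m.xH ≥ H ∧ m.xL ≤ L) ∧
    (μ0 < vL / vH →
      ∀ m : Mech, IsMaximizer {m' | FeasMinus L H vL vH μ0 V m'} (Psi vL vH μ0) m →
        m.xH ≥ H ∧ m.xL ≤ L) := by
  refine ⟨fun _ m hm => ⟨?_, ?_⟩, fun _ m hm => ⟨?_, ?_⟩⟩ <;> by_contra! hx
  · exact (hm.2 _ (FeasPlus.efficientH hLH hx hm.1)).not_gt (Phi_lt_efficientH hμ hx)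
  · exact (hm.2 _ (FeasPlus.efficientL hLH hx hm.1)).not_gt (Phi_lt_efficientL hμ hx)
  · exact (hm.2 _ (FeasMinus.efficientH hLH hx hm.1)).not_gt (Psi_lt_efficientH hμ hx)
  · exact (hm.2 _ (FeasMinus.efficientL hLH hx hm.1)).not_gt (Psi_lt_efficientL hμ hx)
end

section
/- Fix reals L, H with δ := H − L > 0, reals 0 < v_L < v_H with Δv := v_H − v_L, μ0 ∈ (0,1), and a real V. Consider the large-prior problem (when μ0 > v_L/v_H) or the small-prior problem (when μ0 < v_L/v_H) with the additional restriction that x_H ∈ {L, H} and x_L ∈ {L, H} (binary service space). Then every maximizer of the respective objective over the respective restricted feasible set satisfies x_H = H and x_L = L. -/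
/-- Serve each type its ideal service and raise its fee by the disutility thereby saved. -/
def Mech.efficient (L H : ℝ) (m : Mech) : Mech :=
  ⟨H, L, m.fH + (m.xH - H) ^ 2, m.fL + (m.xL - L) ^ 2, m.piL, m.piH⟩

theorem sq_sub_right_le_of_binary {L H x : ℝ} (hx : x = L ∨ x = H) :
    (x - H) ^ 2 ≤ (L - H) ^ 2 + (x - L) ^ 2 := by
  rcases hx with rfl | rfl
  · simp
  · rw [sub_self, zero_pow two_ne_zero]
    positivity

theorem sq_sub_left_le_of_binary {L H x : ℝ} (hx : x = L ∨ x = H) :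
    (x - L) ^ 2 ≤ (H - L) ^ 2 + (x - H) ^ 2 :=
  sq_sub_right_le_of_binary hx.symm

theorem FeasPlus.efficient {L H vL vH μ0 V : ℝ} {m : Mech} (h : FeasPlus L H vL vH μ0 V m)
    (hH : m.xH = L ∨ m.xH = H) (hL : m.xL = L ∨ m.xL = H) :
    FeasPlus L H vL vH μ0 V (m.efficient L H) := by
  obtain ⟨h1, h2, h3, h4, icH, icL, irH, irL, ob⟩ := h
  have hxL := sq_sub_right_le_of_binary hL
  have hxH := sq_sub_left_le_of_binary hH
  refine ⟨h1, h2, h3, h4, ?_, ?_, ?_, ?_, ob⟩ <;> simp only [Mech.efficient] <;> linarith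

theorem FeasMinus.efficient {L H vL vH μ0 V : ℝ} {m : Mech} (h : FeasMinus L H vL vH μ0 V m)
    (hH : m.xH = L ∨ m.xH = H) (hL : m.xL = L ∨ m.xL = H) :
    FeasMinus L H vL vH μ0 V (m.efficient L H) := by
  obtain ⟨h1, h2, h3, h4, icH, icL, irH, irL, ob⟩ := h
  have hxL := sq_sub_right_le_of_binary hL
  have hxH := sq_sub_left_le_of_binary hH
  refine ⟨h1, h2, h3, h4, ?_, ?_, ?_, ?_, ob⟩ <;> simp only [Mech.efficient] <;> linarith

theorem Phi_efficient (L H vL vH μ0 : ℝ) (m : Mech) :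
    Phi vL vH μ0 (m.efficient L H) =
      Phi vL vH μ0 m + (μ0 * (m.xH - H) ^ 2 + (1 - μ0) * (m.xL - L) ^ 2) := by
  simp only [Phi, Mech.efficient]
  ring

theorem Psi_efficient (L H vL vH μ0 : ℝ) (m : Mech) :
    Psi vL vH μ0 (m.efficient L H) =
      Psi vL vH μ0 m + (μ0 * (m.xH - H) ^ 2 + (1 - μ0) * (m.xL - L) ^ 2) := by
  simp only [Psi, Mech.efficient]
  ring

theorem eq_and_eq_of_weighted_sq_nonpos {μ0 a b H L : ℝ} (hμ : μ0 ∈ Set.Ioo (0 : ℝ) 1)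
    (h : μ0 * (a - H) ^ 2 + (1 - μ0) * (b - L) ^ 2 ≤ 0) : a = H ∧ b = L := by
  have h0 := hμ.1
  have h1 : 0 < 1 - μ0 := sub_pos.2 hμ.2
  have ha : 0 ≤ μ0 * (a - H) ^ 2 := by positivity
  have hb : 0 ≤ (1 - μ0) * (b - L) ^ 2 := by positivity
  have ha' : μ0 * (a - H) ^ 2 = 0 := by linarith
  have hb' : (1 - μ0) * (b - L) ^ 2 = 0 := by linarith
  constructor
  · simpa [h0.ne', sub_eq_zero] using ha'
  · simpa [h1.ne', sub_eq_zero] using hb'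

theorem stmt2 (L H vL vH μ0 V : ℝ) (hLH : L < H) (hvL : 0 < vL) (hv : vL < vH)
    (hμ : μ0 ∈ Set.Ioo (0:ℝ) 1) :
    (μ0 > vL / vH →
      ∀ m : Mech, IsMaximizer
          {m' | FeasPlus L H vL vH μ0 V m' ∧ (m'.xH = L ∨ m'.xH = H) ∧ (m'.xL = L ∨ m'.xL = H)}
          (Phi vL vH μ0) m →
        m.xH = H ∧ m.xL = L) ∧
    (μ0 < vL / vH →
      ∀ m : Mech, IsMaximizer
          {m' | FeasMinus L H vL vH μ0 V m' ∧ (m'.xH = L ∨ m'.xH = H) ∧ (m'.xL = L ∨ m'.xL = H)}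
          (Psi vL vH μ0) m →
        m.xH = H ∧ m.xL = L) := by
  constructor
  · rintro - m ⟨⟨hm, hH, hL⟩, hmax⟩
    have h := hmax (m.efficient L H) ⟨hm.efficient hH hL, Or.inr rfl, Or.inl rfl⟩
    rw [Phi_efficient] at h
    exact eq_and_eq_of_weighted_sq_nonpos hμ (by linarith)
  · rintro - m ⟨⟨hm, hH, hL⟩, hmax⟩
    have h := hmax (m.efficient L H) ⟨hm.efficient hH hL, Or.inr rfl, Or.inl rfl⟩
    rw [Psi_efficient] at h
    exact eq_and_eq_of_weighted_sq_nonpos hμ (by linarith)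
end

section
/- Fix reals L, H with δ := H − L > 0, reals 0 < v_L < v_H with Δv := v_H − v_L, μ0 ∈ (0,1) with μ0 > v_L/v_H, a real V, and C := ((1−μ0)·v_L)/(μ0·Δv). Consider the large-prior problem restricted to mechanisms with x_H = H and x_L = L (binary service space). Let p* := min(δ²/Δv, 1). Then the maximum of Φ over this restricted feasible set equals V + (1−μ0)·v_L·p*, and a restricted-feasible mechanism m is a maximizer if and only if f_L = V, f_H = V + πH·Δv, πL = p*, and 0 ≤ πH ≤ C·p*. -/
/-- With the binary service space, raising `piL` by the slack in the high type's participation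
constraint cannot pay for itself: the shortfall of `Phi` from its maximum is bounded below. -/
lemma Phi_add_slack_le {L H vL vH μ0 V : ℝ} (hvL : 0 < vL) (hv : vL < vH) (hμ : μ0 < 1)
    {m : Mech} (hm : FeasPlus L H vL vH μ0 V m) (hH : m.xH = H) (hL : m.xL = L) :
    Phi vL vH μ0 m + (1 - μ0) * (V - m.fL)
        + (μ0 - (1 - μ0) * vL / (vH - vL)) * (V - (m.fH - m.piH * (vH - vL)))
      ≤ V + (1 - μ0) * vL * min ((H - L)^2 / (vH - vL)) 1 := by
  obtain ⟨-, hL1, -, -, hIC, -, hIRH, hIRL, -⟩ := hm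
  rw [hH, hL] at hIC
  rw [hH] at hIRH
  rw [hL] at hIRL
  have hD : 0 < vH - vL := sub_pos.2 hv
  have hK : 0 ≤ (1 - μ0) * vL := mul_nonneg (by linarith) hvL.le
  have hpi : m.piL - (V - (m.fH - m.piH * (vH - vL))) / (vH - vL)
      ≤ min ((H - L)^2 / (vH - vL)) 1 := by
    refine le_min ?_ ?_
    · rw [sub_le_iff_le_add, ← add_div, le_div_iff₀ hD]
      linarith
    · have : 0 ≤ (V - (m.fH - m.piH * (vH - vL))) / (vH - vL) :=
        div_nonneg (by linarith) hD.le
      linarith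
  have hmul := mul_le_mul_of_nonneg_left hpi hK
  have hcomm : (1 - μ0) * vL / (vH - vL) * (V - (m.fH - m.piH * (vH - vL)))
      = (1 - μ0) * vL * ((V - (m.fH - m.piH * (vH - vL))) / (vH - vL)) := by ring
  unfold Phi
  linarith

/-- The mechanism charging `V` to both types and disclosing only to the low type is feasible. -/
lemma feasPlus_flat_fee {L H vL vH μ0 V : ℝ} (hvL : 0 < vL) (hv : vL < vH) (hμ : μ0 < 1) :
    FeasPlus L H vL vH μ0 V ⟨H, L, V, V, min ((H - L)^2 / (vH - vL)) 1, 0⟩ := by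
  have hD : 0 < vH - vL := sub_pos.2 hv
  have hp : 0 ≤ min ((H - L)^2 / (vH - vL)) 1 :=
    le_min (div_nonneg (sq_nonneg _) hD.le) zero_le_one
  have hpD : min ((H - L)^2 / (vH - vL)) 1 * (vH - vL) ≤ (H - L)^2 :=
    (le_div_iff₀ hD).1 (min_le_left _ _)
  refine ⟨hp, min_le_right _ _, le_rfl, zero_le_one, ?_, ?_, ?_, ?_, ?_⟩ <;> dsimp only
  · linarith
  · linarith [sq_nonneg (H - L)]
  · linarith
  · linarith
  · rw [mul_zero]
    exact mul_nonneg (mul_nonneg (div_nonneg hvL.le (hvL.trans hv).le) (by linarith)) hp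

/-- The obedience constraint in the form `piH ≤ C * piL`. -/
lemma piH_le_of_obedience {vL vH μ0 a b : ℝ} (hvL : 0 < vL) (hv : vL < vH) (hμ : 0 < μ0)
    (h : (1 - vL / vH) * μ0 * a ≤ (vL / vH) * (1 - μ0) * b) :
    a ≤ ((1 - μ0) * vL / (μ0 * (vH - vL))) * b := by
  have hvH : 0 < vH := hvL.trans hv
  rw [div_mul_eq_mul_div, le_div_iff₀ (mul_pos hμ (sub_pos.2 hv))]
  have h' := mul_le_mul_of_nonneg_left h hvH.le
  have hl : vH * ((1 - vL / vH) * μ0 * a) = a * (μ0 * (vH - vL)) := by field_simp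
  have hr : vH * ((vL / vH) * (1 - μ0) * b) = (1 - μ0) * vL * b := by field_simp
  rwa [hl, hr] at h'

theorem stmt3 (L H vL vH μ0 V : ℝ) (hLH : L < H) (hvL : 0 < vL) (hv : vL < vH)
    (hμ : μ0 ∈ Set.Ioo (0:ℝ) 1) (hprior : μ0 > vL / vH) :
    IsGreatest
      (Phi vL vH μ0 '' {m | FeasPlus L H vL vH μ0 V m ∧ m.xH = H ∧ m.xL = L})
      (V + (1 - μ0) * vL * min ((H - L)^2 / (vH - vL)) 1) ∧
    ∀ m : Mech, (FeasPlus L H vL vH μ0 V m ∧ m.xH = H ∧ m.xL = L) →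
      (IsMaximizer {m' | FeasPlus L H vL vH μ0 V m' ∧ m'.xH = H ∧ m'.xL = L}
          (Phi vL vH μ0) m ↔
        (m.fL = V ∧ m.fH = V + m.piH * (vH - vL) ∧
          m.piL = min ((H - L)^2 / (vH - vL)) 1 ∧
          0 ≤ m.piH ∧
          m.piH ≤ ((1 - μ0) * vL / (μ0 * (vH - vL))) * min ((H - L)^2 / (vH - vL)) 1)) := by
  have hD : 0 < vH - vL := sub_pos.2 hv
  have hslope : 0 < μ0 - (1 - μ0) * vL / (vH - vL) := by
    rw [sub_pos, div_lt_iff₀ hD]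
    linarith [(div_lt_iff₀ (hvL.trans hv)).1 hprior]
  have hμ1 : 0 < 1 - μ0 := sub_pos.2 hμ.2
  have hslack : ∀ m : Mech, FeasPlus L H vL vH μ0 V m → m.xH = H → m.xL = L →
      0 ≤ V - m.fL ∧ 0 ≤ V - (m.fH - m.piH * (vH - vL)) := by
    rintro m ⟨-, -, -, -, -, -, hIRH, hIRL, -⟩ hH hL
    rw [hH] at hIRH
    rw [hL] at hIRL
    constructor <;> linarith
  have hub : ∀ m : Mech, FeasPlus L H vL vH μ0 V m → m.xH = H → m.xL = L →
      Phi vL vH μ0 m ≤ V + (1 - μ0) * vL * min ((H - L)^2 / (vH - vL)) 1 := by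
    intro m hm hH hL
    obtain ⟨ht, hs⟩ := hslack m hm hH hL
    linarith [Phi_add_slack_le hvL hv hμ.2 hm hH hL, mul_nonneg hμ1.le ht,
      mul_nonneg hslope.le hs]
  have hgreatest : IsGreatest
      (Phi vL vH μ0 '' {m | FeasPlus L H vL vH μ0 V m ∧ m.xH = H ∧ m.xL = L})
      (V + (1 - μ0) * vL * min ((H - L)^2 / (vH - vL)) 1) := by
    refine ⟨⟨_, ⟨feasPlus_flat_fee hvL hv hμ.2, rfl, rfl⟩, ?_⟩, ?_⟩
    · dsimp only [Phi]
      ring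
    · rintro _ ⟨m, ⟨hm, hH, hL⟩, rfl⟩
      exact hub m hm hH hL
  refine ⟨hgreatest, ?_⟩
  rintro m ⟨hm, hH, hL⟩
  constructor
  · rintro ⟨-, hmax⟩
    obtain ⟨m₀, hm₀, hval⟩ := hgreatest.1
    have hge := hmax m₀ hm₀
    rw [hval] at hge
    obtain ⟨ht, hs⟩ := hslack m hm hH hL
    have hgap := Phi_add_slack_le hvL hv hμ.2 hm hH hL
    have ht' := mul_nonneg hμ1.le ht
    have hs' := mul_nonneg hslope.le hs
    have hfL : m.fL = V := by
      have : V - m.fL = 0 :=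
        (mul_eq_zero.1 (le_antisymm (by linarith) ht')).resolve_left hμ1.ne'
      linarith
    have hfH : m.fH = V + m.piH * (vH - vL) := by
      have : V - (m.fH - m.piH * (vH - vL)) = 0 :=
        (mul_eq_zero.1 (le_antisymm (by linarith) hs')).resolve_left hslope.ne'
      linarith
    have hpiL : m.piL = min ((H - L)^2 / (vH - vL)) 1 := by
      have hle := hub m hm hH hL
      rw [Phi, hfL, hfH] at hge hle
      refine mul_left_cancel₀ (mul_pos hμ1 hvL).ne' ?_
      linarith
    obtain ⟨-, -, h0, -, -, -, -, -, hOB⟩ := hm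
    refine ⟨hfL, hfH, hpiL, h0, ?_⟩
    rw [← hpiL]
    exact piH_le_of_obedience hvL hv hμ.1 hOB
  · rintro ⟨hfL, hfH, hpiL, -, -⟩
    refine ⟨⟨hm, hH, hL⟩, ?_⟩
    rintro m' ⟨hm', hH', hL'⟩
    refine (hub m' hm' hH' hL').trans_eq ?_
    rw [Phi, hfL, hfH, hpiL]
    ring
end

section
/- Fix reals L, H with δ := H − L > 0, reals 0 < v_L < v_H with Δv := v_H − v_L, μ0 ∈ (0,1) with μ0 < v_L/v_H, and a real V. Consider the small-prior problem restricted to mechanisms with x_H = H and x_L = L (binary service space). Then the maximum of Ψ over this restricted feasible set equals V, and a restricted-feasible mechanism m is a maximizer if and only if f_L = V, f_H = V + (πH − 1)·Δv, πL = 1, and max(1 − δ²/Δv, 0) ≤ πH ≤ 1. -/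
/-- With the service provisions at the bliss points, the gap `V - Ψ` is a nonnegative combination
of the slacks in the two participation constraints and in `πL ≤ 1`. -/
lemma sub_Psi_eq (vL vH μ0 V : ℝ) (m : Mech) :
    V - Psi vL vH μ0 m =
      μ0 * (V - m.fH + m.piH * (vH - vL) - (vH - vL)) + (1 - μ0) * (V - m.fL) +
        (1 - μ0) * vL * (1 - m.piL) := by
  unfold Psi; ring

lemma Psi_le_of_feasMinus {L H vL vH μ0 V : ℝ} (hvL : 0 < vL) (hμ : μ0 ∈ Set.Ioo (0:ℝ) 1)
    {m : Mech} (hm : FeasMinus L H vL vH μ0 V m) (hH : m.xH = H) (hL : m.xL = L) :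
    Psi vL vH μ0 m ≤ V := by
  obtain ⟨-, hpL, -, -, -, -, hIRH, hIRL, -⟩ := hm
  rw [hH] at hIRH
  rw [hL] at hIRL
  have h0 : 0 < 1 - μ0 := sub_pos.2 hμ.2
  have h1 := mul_nonneg hμ.1.le
    (show 0 ≤ V - m.fH + m.piH * (vH - vL) - (vH - vL) by linarith)
  have h2 := mul_nonneg h0.le (show 0 ≤ V - m.fL by linarith)
  have h3 := mul_nonneg (mul_pos h0 hvL).le (sub_nonneg.2 hpL)
  linarith [sub_Psi_eq vL vH μ0 V m]

lemma Psi_eq_iff_of_feasMinus {L H vL vH μ0 V : ℝ} (hvL : 0 < vL) (hμ : μ0 ∈ Set.Ioo (0:ℝ) 1)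
    {m : Mech} (hm : FeasMinus L H vL vH μ0 V m) (hH : m.xH = H) (hL : m.xL = L) :
    Psi vL vH μ0 m = V ↔
      m.fL = V ∧ m.fH = V + (m.piH - 1) * (vH - vL) ∧ m.piL = 1 := by
  obtain ⟨-, hpL, -, -, -, -, hIRH, hIRL, -⟩ := hm
  rw [hH] at hIRH
  rw [hL] at hIRL
  have h0 : 0 < 1 - μ0 := sub_pos.2 hμ.2
  have h1 := mul_nonneg hμ.1.le
    (show 0 ≤ V - m.fH + m.piH * (vH - vL) - (vH - vL) by linarith)
  have h2 := mul_nonneg h0.le (show 0 ≤ V - m.fL by linarith)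
  have h3 := mul_nonneg (mul_pos h0 hvL).le (sub_nonneg.2 hpL)
  have key := sub_Psi_eq vL vH μ0 V m
  constructor
  · intro h
    have e1 := (mul_eq_zero_iff_left hμ.1.ne').1 (le_antisymm (by linarith) h1)
    have e2 := (mul_eq_zero_iff_left h0.ne').1 (le_antisymm (by linarith) h2)
    have e3 := (mul_eq_zero_iff_left (mul_pos h0 hvL).ne').1 (le_antisymm (by linarith) h3)
    exact ⟨by linarith, by linarith, by linarith⟩
  · rintro ⟨e1, e2, e3⟩
    rw [e1, e2, e3] at key
    linarith

theorem stmt4 (L H vL vH μ0 V : ℝ) (hLH : L < H) (hvL : 0 < vL) (hv : vL < vH)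
    (hμ : μ0 ∈ Set.Ioo (0:ℝ) 1) (hprior : μ0 < vL / vH) :
    IsGreatest
      (Psi vL vH μ0 '' {m | FeasMinus L H vL vH μ0 V m ∧ m.xH = H ∧ m.xL = L}) V ∧
    ∀ m : Mech, (FeasMinus L H vL vH μ0 V m ∧ m.xH = H ∧ m.xL = L) →
      (IsMaximizer {m' | FeasMinus L H vL vH μ0 V m' ∧ m'.xH = H ∧ m'.xL = L}
          (Psi vL vH μ0) m ↔
        (m.fL = V ∧ m.fH = V + (m.piH - 1) * (vH - vL) ∧ m.piL = 1 ∧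
          max (1 - (H - L)^2 / (vH - vL)) 0 ≤ m.piH ∧ m.piH ≤ 1)) := by
  have hd : 0 < vH - vL := sub_pos.2 hv
  have hgreatest : IsGreatest
      (Psi vL vH μ0 '' {m | FeasMinus L H vL vH μ0 V m ∧ m.xH = H ∧ m.xL = L}) V := by
    refine ⟨⟨⟨H, L, V, V, 1, 1⟩, ⟨⟨?_, ?_, ?_, ?_, ?_, ?_, ?_, ?_, ?_⟩, rfl, rfl⟩, ?_⟩, ?_⟩
    iterate 9 (dsimp only; nlinarith [sq_nonneg (H - L)])
    · unfold Psi; ring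
    · rintro _ ⟨m, ⟨hm, hH, hL⟩, rfl⟩
      exact Psi_le_of_feasMinus hvL hμ hm hH hL
  refine ⟨hgreatest, fun m ⟨hm, hH, hL⟩ => ?_⟩
  have hmax : IsMaximizer {m' | FeasMinus L H vL vH μ0 V m' ∧ m'.xH = H ∧ m'.xL = L}
      (Psi vL vH μ0) m ↔ Psi vL vH μ0 m = V := by
    constructor
    · rintro ⟨-, h⟩
      obtain ⟨m', hm', hV⟩ := hgreatest.1
      exact le_antisymm (Psi_le_of_feasMinus hvL hμ hm hH hL) (hV ▸ h m' hm')
    · intro h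
      exact ⟨⟨hm, hH, hL⟩, fun m' hm' => h ▸ hgreatest.2 ⟨m', hm', rfl⟩⟩
  rw [hmax, Psi_eq_iff_of_feasMinus hvL hμ hm hH hL]
  refine ⟨fun ⟨e1, e2, e3⟩ => ⟨e1, e2, e3, ?_, hm.2.2.2.1⟩, fun ⟨e1, e2, e3, _⟩ => ⟨e1, e2, e3⟩⟩
  obtain ⟨-, -, hp, -, -, hICL, -⟩ := hm
  rw [hH, hL, e1, e2] at hICL
  refine max_le ?_ hp
  rw [sub_le_comm, le_div_iff₀ hd]
  linarith
end

section
/- Fix reals L, H with δ := H − L > 0, reals 0 < v_L < v_H with Δv := v_H − v_L, μ0 ∈ (0,1) with μ0 > v_L/v_H, a real V, and C := ((1−μ0)·v_L)/(μ0·Δv). Assume (Δv)²/(v_L+v_H) < δ² < Δv. Then the maximum of Φ over the large-prior feasible set F⁺ equals V + (1−μ0)·v_L − (1−μ0)·((Δv−δ²)/(2δ))², and a mechanism m ∈ F⁺ is a maximizer if and only if x_H = H, x_L = L − (Δv−δ²)/(2δ), f_L = V − ((Δv−δ²)/(2δ))², f_H = V + πH·Δv, πL = 1, and 0 ≤ πH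 ≤ C. -/
/-- The gap between the optimal value and `Phi m`, written as a combination of constraint slacks:
`k` and `(1 - μ0) * k` are the normalized distortion and the multiplier of the high type's
incentive constraint. -/
lemma value_sub_phi_eq (L H vL vH μ0 V k : ℝ) (m : Mech)
    (hk : 2 * k * (H - L)^2 = (vH - vL) - (H - L)^2) :
    V + (1 - μ0) * vL - (1 - μ0) * (k * (H - L))^2 - Phi vL vH μ0 m =
      μ0 * (m.xH - H)^2 + (1 - μ0) * (m.xL - (L - k * (H - L)))^2
      + (μ0 - (1 - μ0) * k) * (V - (m.xH - H)^2 - m.fH + m.piH * (vH - vL))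
      + ((1 - μ0) + (1 - μ0) * k) * (V - (m.xL - L)^2 - m.fL)
      + ((1 - μ0) * k) * ((-(m.xH - H)^2 - m.fH + m.piH * (vH - vL))
          - (-(m.xL - H)^2 - m.fL + m.piL * (vH - vL)))
      + ((1 - μ0) * (vL - k * (vH - vL))) * (1 - m.piL) := by
  unfold Phi
  linear_combination (-(1 - μ0) * k) * hk

/-- The quantity `k = (Δv - δ²) / (2δ²)` is a normalized distortion for which all multipliers are
positive. -/
lemma exists_distortion {L H vL vH μ0 : ℝ} (hLH : L < H) (hvL : 0 < vL) (hv : vL < vH)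
    (hμ : μ0 ∈ Set.Ioo (0:ℝ) 1) (hprior : μ0 > vL / vH)
    (hδlow : (vH - vL)^2 / (vL + vH) < (H - L)^2) (hδhigh : (H - L)^2 < vH - vL) :
    ∃ k : ℝ, 0 < k ∧ 2 * k * (H - L)^2 = (vH - vL) - (H - L)^2 ∧
      ((vH - vL) - (H - L)^2) / (2 * (H - L)) = k * (H - L) ∧
      k * (vH - vL) < vL ∧ (1 - μ0) * k < μ0 := by
  have hδ : 0 < H - L := sub_pos.2 hLH
  have hΔ : 0 < vH - vL := sub_pos.2 hv
  have hμ1 : 0 < 1 - μ0 := sub_pos.2 hμ.2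
  rw [div_lt_iff₀ (by linarith)] at hδlow
  rw [gt_iff_lt, div_lt_iff₀ (by linarith)] at hprior
  have hkv : ((vH - vL) - (H - L)^2) / (2 * (H - L)^2) * (vH - vL) < vL := by
    rw [div_mul_eq_mul_div, div_lt_iff₀ (by positivity)]
    linarith
  refine ⟨((vH - vL) - (H - L)^2) / (2 * (H - L)^2), div_pos (by linarith) (by positivity),
    by field_simp, by field_simp, hkv, ?_⟩
  refine lt_of_mul_lt_mul_right ?_ hΔ.le
  linarith [mul_lt_mul_of_pos_left hkv hμ1]

/-- The obedience constraint at `piL = 1` bounds `piH`. -/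
lemma obedience_one_iff {vL vH μ0 p : ℝ} (hvH : 0 < vH) (hv : vL < vH) (hμ : 0 < μ0) :
    (1 - vL / vH) * μ0 * p ≤ (vL / vH) * (1 - μ0) * 1 ↔
      p ≤ (1 - μ0) * vL / (μ0 * (vH - vL)) := by
  have hΔ : 0 < vH - vL := sub_pos.2 hv
  rw [le_div_iff₀ (by positivity), ← mul_le_mul_iff_of_pos_right hvH]
  have h₁ : (1 - vL / vH) * μ0 * p * vH = p * (μ0 * (vH - vL)) := by field_simp
  have h₂ : (vL / vH) * (1 - μ0) * 1 * vH = (1 - μ0) * vL := by field_simp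
  rw [h₁, h₂]

theorem stmt7 (L H vL vH μ0 V : ℝ) (hLH : L < H) (hvL : 0 < vL) (hv : vL < vH)
    (hμ : μ0 ∈ Set.Ioo (0:ℝ) 1) (hprior : μ0 > vL / vH)
    (hδlow : (vH - vL)^2 / (vL + vH) < (H - L)^2) (hδhigh : (H - L)^2 < vH - vL) :
    IsGreatest (Phi vL vH μ0 '' {m | FeasPlus L H vL vH μ0 V m})
      (V + (1 - μ0) * vL - (1 - μ0) * (((vH - vL) - (H - L)^2) / (2 * (H - L)))^2) ∧
    ∀ m : Mech, FeasPlus L H vL vH μ0 V m →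
      (IsMaximizer {m' | FeasPlus L H vL vH μ0 V m'} (Phi vL vH μ0) m ↔
        (m.xH = H ∧ m.xL = L - ((vH - vL) - (H - L)^2) / (2 * (H - L)) ∧
          m.fL = V - (((vH - vL) - (H - L)^2) / (2 * (H - L)))^2 ∧
          m.fH = V + m.piH * (vH - vL) ∧ m.piL = 1 ∧
          0 ≤ m.piH ∧ m.piH ≤ (1 - μ0) * vL / (μ0 * (vH - vL)))) := by
  obtain ⟨k, hk0, hk, hs, hkv, hkμ⟩ := exists_distortion hLH hvL hv hμ hprior hδlow hδhigh
  rw [hs]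
  obtain ⟨hμ0, hμ1'⟩ := hμ
  have hμ1 : 0 < 1 - μ0 := sub_pos.2 hμ1'
  have hvH : 0 < vH := hvL.trans hv
  have hΔ : 0 < vH - vL := sub_pos.2 hv
  have hcH : 0 < μ0 - (1 - μ0) * k := sub_pos.2 hkμ
  have hcL : 0 < (1 - μ0) + (1 - μ0) * k := by positivity
  have hcP : 0 < (1 - μ0) * (vL - k * (vH - vL)) := mul_pos hμ1 (sub_pos.2 hkv)
  have hbound : ∀ m, FeasPlus L H vL vH μ0 V m →
      Phi vL vH μ0 m ≤ V + (1 - μ0) * vL - (1 - μ0) * (k * (H - L))^2 := by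
    rintro m ⟨-, hL1, -, -, hICH, -, hIRH, hIRL, -⟩
    rw [← sub_nonneg, value_sub_phi_eq L H vL vH μ0 V k m hk]
    have := sub_nonneg.2 hICH
    have := sub_nonneg.2 hL1
    positivity
  have hvalue : ∀ m : Mech, m.xH = H → m.xL = L - k * (H - L) →
      m.fL = V - (k * (H - L))^2 → m.fH = V + m.piH * (vH - vL) → m.piL = 1 →
      Phi vL vH μ0 m = V + (1 - μ0) * vL - (1 - μ0) * (k * (H - L))^2 := by
    intro m h₁ h₂ h₃ h₄ h₅
    simp only [Phi, h₃, h₄, h₅]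
    ring
  have hfeas : FeasPlus L H vL vH μ0 V ⟨H, L - k * (H - L), V, V - (k * (H - L))^2, 1, 0⟩ := by
    refine ⟨zero_le_one, le_rfl, le_rfl, zero_le_one, ?_, ?_, ?_, ?_, ?_⟩
    · dsimp only
      linarith
    · dsimp only
      linarith [sq_nonneg (H - L)]
    · dsimp only
      linarith
    · dsimp only
      linarith
    · exact (obedience_one_iff hvH hv hμ0).2 (by positivity)
  have hopt := hvalue ⟨H, L - k * (H - L), V, V - (k * (H - L))^2, 1, 0⟩
    rfl rfl rfl (by simp) rfl
  refine ⟨⟨⟨_, hfeas, hopt⟩, ?_⟩, fun m hm => ⟨fun hmax => ?_, ?_⟩⟩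
  · rintro _ ⟨m, hm, rfl⟩
    exact hbound m hm
  · have hgap := value_sub_phi_eq L H vL vH μ0 V k m hk
    have hle := hopt ▸ hmax.2 _ hfeas
    obtain ⟨-, hL1, hH0, -, hICH, -, hIRH, hIRL, hOB⟩ := hm
    have t₁ := mul_nonneg hμ0.le (sq_nonneg (m.xH - H))
    have t₂ := mul_nonneg hμ1.le (sq_nonneg (m.xL - (L - k * (H - L))))
    have t₃ := mul_nonneg hcH.le hIRH
    have t₄ := mul_nonneg hcL.le hIRL
    have t₅ := mul_nonneg (mul_pos hμ1 hk0).le (sub_nonneg.2 hICH)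
    have t₆ := mul_nonneg hcP.le (sub_nonneg.2 hL1)
    have hxH : m.xH - H = 0 := by
      refine pow_eq_zero_iff two_ne_zero |>.1 <| (mul_eq_zero_iff_left hμ0.ne').1 ?_
      linarith
    have hxL : m.xL - (L - k * (H - L)) = 0 := by
      refine pow_eq_zero_iff two_ne_zero |>.1 <| (mul_eq_zero_iff_left hμ1.ne').1 ?_
      linarith
    have hfH : V - (m.xH - H)^2 - m.fH + m.piH * (vH - vL) = 0 := by
      refine (mul_eq_zero_iff_left hcH.ne').1 ?_
      linarith
    have hfL : V - (m.xL - L)^2 - m.fL = 0 := by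
      refine (mul_eq_zero_iff_left hcL.ne').1 ?_
      linarith
    have hpL : 1 - m.piL = 0 := by
      refine (mul_eq_zero_iff_left hcP.ne').1 ?_
      linarith
    have hpL' : m.piL = 1 := by linarith
    have hxL' : m.xL = L - k * (H - L) := by linarith
    rw [hxH] at hfH
    rw [hxL'] at hfL
    rw [hpL'] at hOB
    exact ⟨by linarith, hxL', by linarith, by linarith, hpL', hH0,
      (obedience_one_iff hvH hv hμ0).1 hOB⟩
  · rintro ⟨h₁, h₂, h₃, h₄, h₅, -, -⟩
    refine ⟨hm, fun m' hm' => ?_⟩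
    rw [hvalue m h₁ h₂ h₃ h₄ h₅]
    exact hbound m' hm'
end

section
/- Fix reals L, H with δ := H − L > 0, reals 0 < v_L < v_H with Δv := v_H − v_L, μ0 ∈ (0,1) with μ0 > v_L/v_H, a real V, and C := ((1−μ0)·v_L)/(μ0·Δv). Assume δ² ≤ (Δv)²/(v_L+v_H). Then the maximum of Φ over the large-prior feasible set F⁺ equals V + (1−μ0)·(δ/Δv)²·v_L·v_H, and a mechanism m ∈ F⁺ is a maximizer if and only if x_H = H, x_L = L − δ·v_L/Δv, f_L = V − (δ·v_L/Δv)², f_H = V + πH·Δv, πL = δ²·(v_H+v_L)/(Δv)², and 0 ≤ πH ≤ C·πL. -/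
/-- The gap between the upper bound and `Φ` is a weighted sum of the slacks of the two
participation constraints, the slack of `IC_H`, and two squares. -/
lemma Phi_eq_bound_sub_slacks {vL vH : ℝ} (hv : vL < vH) (L H μ0 V : ℝ) (m : Mech) :
    Phi vL vH μ0 m = V + (1 - μ0) * ((H - L) / (vH - vL))^2 * vL * vH
      - ((μ0 * vH - vL) / (vH - vL)) * (V - (m.xH - H)^2 - m.fH + m.piH * (vH - vL))
      - ((1 - μ0) * vL / (vH - vL)) * (-(m.xH - H)^2 - m.fH + m.piH * (vH - vL)
          - (-(m.xL - H)^2 - m.fL + m.piL * (vH - vL)))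
      - ((1 - μ0) * vH / (vH - vL)) * (V - (m.xL - L)^2 - m.fL)
      - μ0 * (m.xH - H)^2 - (1 - μ0) * (m.xL - (L - (H - L) * vL / (vH - vL)))^2 := by
  have hΔ : vH - vL ≠ 0 := (sub_pos.2 hv).ne'
  unfold Phi
  field_simp
  ring

/-- The obedience constraint bounds `πH` by a multiple of `πL`. -/
lemma obedience_iff {vL vH μ0 : ℝ} (hvL : 0 < vL) (hv : vL < vH) (hμ : 0 < μ0) (p q : ℝ) :
    (1 - vL / vH) * μ0 * p ≤ (vL / vH) * (1 - μ0) * q ↔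
      p ≤ ((1 - μ0) * vL / (μ0 * (vH - vL))) * q := by
  have hvH : 0 < vH := hvL.trans hv
  have hΔ : 0 < vH - vL := sub_pos.2 hv
  have h₁ : (1 - vL / vH) * μ0 * p = p * (μ0 * (vH - vL)) / vH := by field_simp
  have h₂ : (vL / vH) * (1 - μ0) * q = (1 - μ0) * vL * q / vH := by field_simp
  rw [h₁, h₂, div_le_div_iff_of_pos_right hvH, div_mul_eq_mul_div, le_div_iff₀ (by positivity)]

/-- The candidate optimum with no disclosure in the high state. -/
noncomputable def optimalMech (L H vL vH V : ℝ) : Mech where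
  xH := H
  xL := L - (H - L) * vL / (vH - vL)
  fH := V
  fL := V - ((H - L) * vL / (vH - vL))^2
  piL := (H - L)^2 * (vH + vL) / (vH - vL)^2
  piH := 0

lemma optimalMech_feasPlus {L H vL vH μ0 : ℝ} (V : ℝ) (hvL : 0 < vL) (hv : vL < vH)
    (hμ : μ0 ∈ Set.Ioo (0:ℝ) 1) (hδ : (H - L)^2 ≤ (vH - vL)^2 / (vL + vH)) :
    FeasPlus L H vL vH μ0 V (optimalMech L H vL vH V) := by
  have hvH : 0 < vH := hvL.trans hv
  have hΔ : 0 < vH - vL := sub_pos.2 hv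
  have hpi : 0 ≤ (H - L)^2 * (vH + vL) / (vH - vL)^2 := by positivity
  refine ⟨hpi, ?_, le_rfl, zero_le_one, ?_, ?_, ?_, ?_, ?_⟩ <;> simp only [optimalMech]
  · rw [le_div_iff₀ (by positivity)] at hδ
    rw [div_le_one (by positivity)]
    linarith
  · apply ge_of_eq
    field_simp
    ring
  · nlinarith [sq_nonneg (H - L)]
  · simp
  · apply ge_of_eq
    ring
  · rw [mul_zero]
    exact mul_nonneg (mul_nonneg (by positivity) (sub_pos.2 hμ.2).le) hpi

lemma Phi_optimalMech {vL vH : ℝ} (hv : vL < vH) (L H μ0 V : ℝ) :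
    Phi vL vH μ0 (optimalMech L H vL vH V) =
      V + (1 - μ0) * ((H - L) / (vH - vL))^2 * vL * vH := by
  have hΔ : vH - vL ≠ 0 := (sub_pos.2 hv).ne'
  simp only [Phi, optimalMech]
  field_simp
  ring

theorem stmt8 (L H vL vH μ0 V : ℝ) (hLH : L < H) (hvL : 0 < vL) (hv : vL < vH)
    (hμ : μ0 ∈ Set.Ioo (0:ℝ) 1) (hprior : μ0 > vL / vH)
    (hδ : (H - L)^2 ≤ (vH - vL)^2 / (vL + vH)) :
    IsGreatest (Phi vL vH μ0 '' {m | FeasPlus L H vL vH μ0 V m})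
      (V + (1 - μ0) * ((H - L) / (vH - vL))^2 * vL * vH) ∧
    ∀ m : Mech, FeasPlus L H vL vH μ0 V m →
      (IsMaximizer {m' | FeasPlus L H vL vH μ0 V m'} (Phi vL vH μ0) m ↔
        (m.xH = H ∧ m.xL = L - (H - L) * vL / (vH - vL) ∧
          m.fL = V - ((H - L) * vL / (vH - vL))^2 ∧
          m.fH = V + m.piH * (vH - vL) ∧
          m.piL = (H - L)^2 * (vH + vL) / (vH - vL)^2 ∧
          0 ≤ m.piH ∧
          m.piH ≤ ((1 - μ0) * vL / (μ0 * (vH - vL))) * m.piL)) := by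
  obtain ⟨hμ0, hμ1⟩ := hμ
  have hvH : 0 < vH := hvL.trans hv
  have hΔ : 0 < vH - vL := sub_pos.2 hv
  have hμ1' : 0 < 1 - μ0 := sub_pos.2 hμ1
  have hIRH : 0 < (μ0 * vH - vL) / (vH - vL) :=
    div_pos (sub_pos.2 ((div_lt_iff₀ hvH).1 hprior)) hΔ
  have hICH : 0 < (1 - μ0) * vL / (vH - vL) := by positivity
  have hIRL : 0 < (1 - μ0) * vH / (vH - vL) := by positivity
  have hub : ∀ m, FeasPlus L H vL vH μ0 V m →
      Phi vL vH μ0 m ≤ V + (1 - μ0) * ((H - L) / (vH - vL))^2 * vL * vH := by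
    rintro m ⟨-, -, -, -, h₁, -, h₂, h₃, -⟩
    rw [Phi_eq_bound_sub_slacks hv L H μ0 V m]
    have t₁ := mul_nonneg hIRH.le h₂
    have t₂ := mul_nonneg hICH.le (sub_nonneg.2 h₁)
    have t₃ := mul_nonneg hIRL.le h₃
    have t₄ := mul_nonneg hμ0.le (sq_nonneg (m.xH - H))
    have t₅ := mul_nonneg hμ1'.le (sq_nonneg (m.xL - (L - (H - L) * vL / (vH - vL))))
    linarith
  have hopt := optimalMech_feasPlus V hvL hv ⟨hμ0, hμ1⟩ hδ
  have hval := Phi_optimalMech hv L H μ0 V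
  refine ⟨⟨⟨_, hopt, hval⟩, ?_⟩, fun m hm => ⟨fun hmax => ?_, ?_⟩⟩
  · rintro _ ⟨m, hm, rfl⟩
    exact hub m hm
  · have hge := hmax.2 _ hopt
    rw [hval, Phi_eq_bound_sub_slacks hv L H μ0 V m] at hge
    obtain ⟨-, -, hpH, -, h₁, -, h₂, h₃, hob⟩ := hm
    have t₁ := mul_nonneg hIRH.le h₂
    have t₂ := mul_nonneg hICH.le (sub_nonneg.2 h₁)
    have t₃ := mul_nonneg hIRL.le h₃
    have t₄ := mul_nonneg hμ0.le (sq_nonneg (m.xH - H))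
    have t₅ := mul_nonneg hμ1'.le (sq_nonneg (m.xL - (L - (H - L) * vL / (vH - vL))))
    have e₁ := (mul_eq_zero.1 (le_antisymm (by linarith) t₁)).resolve_left hIRH.ne'
    have e₂ := (mul_eq_zero.1 (le_antisymm (by linarith) t₂)).resolve_left hICH.ne'
    have e₃ := (mul_eq_zero.1 (le_antisymm (by linarith) t₃)).resolve_left hIRL.ne'
    have e₄ := (mul_eq_zero.1 (le_antisymm (by linarith) t₄)).resolve_left hμ0.ne'
    have e₅ := (mul_eq_zero.1 (le_antisymm (by linarith) t₅)).resolve_left hμ1'.ne'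
    have hxH : m.xH = H := sub_eq_zero.1 (pow_eq_zero_iff two_ne_zero |>.1 e₄)
    have hxL : m.xL = L - (H - L) * vL / (vH - vL) :=
      sub_eq_zero.1 (pow_eq_zero_iff two_ne_zero |>.1 e₅)
    rw [hxH] at e₁ e₂
    rw [hxL] at e₂ e₃
    have hpiL : m.piL * (vH - vL) = (H - L)^2 + 2 * (H - L) * ((H - L) * vL / (vH - vL)) := by
      linarith
    refine ⟨hxH, hxL, by linarith, by linarith, ?_, hpH, (obedience_iff hvL hv hμ0 _ _).1 hob⟩
    rw [eq_div_iff (by positivity), sq (vH - vL), ← mul_assoc, hpiL]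
    field_simp
    ring
  · rintro ⟨hxH, hxL, hfL, hfH, hpiL, -, -⟩
    refine ⟨hm, fun m' hm' => (hub m' hm').trans_eq ?_⟩
    rw [← hval]
    simp only [Phi, optimalMech, hfL, hfH, hpiL]
    ring
end

section
/- Fix reals L, H with δ := H − L > 0, reals 0 < v_L < v_H with Δv := v_H − v_L, μ0 ∈ (0,1) with μ0 > v_L/v_H, and a real V. Then every maximizer m = (x_H, x_L, f_H, f_L, πL, πH) of Φ over the large-prior feasible set F⁺ satisfies both participation constraints with equality: V − (x_L−L)² − f_L = 0 and V − (x_H−H)² − f_H + πH·Δv = 0. -/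
/-- The bound that a maximizer satisfies against any competitor, with the competitor
described by provisions, disclosure probabilities and the rents `uH, uL` of the two types. -/
theorem IsMaximizer.surplus_le {L H vL vH μ0 V : ℝ} (hvL : 0 < vL) (hv : vL < vH) {m : Mech}
    (hm : IsMaximizer {m' | FeasPlus L H vL vH μ0 V m'} (Phi vL vH μ0) m)
    (xH xL uH uL pL pH : ℝ) (hpL : 0 ≤ pL) (hpL1 : pL ≤ 1) (hpH : 0 ≤ pH) (hpH1 : pH ≤ 1)
    (huH : 0 ≤ uH) (huL : 0 ≤ uL)
    (hICH : (H - L) * (2 * xL - L - H) + pL * (vH - vL) ≤ uH - uL)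
    (hICL : uH - uL ≤ pH * (vH - vL) + (H - L) * (2 * xH - L - H))
    (hOB : (vH - vL) * μ0 * pH ≤ vL * (1 - μ0) * pL) :
    μ0 * (-(xH - H)^2 - uH) + (1 - μ0) * (-(xL - L)^2 - uL + pL * vL) ≤
      μ0 * (-(m.xH - H)^2 - (V - (m.xH - H)^2 - m.fH + m.piH * (vH - vL))) +
      (1 - μ0) * (-(m.xL - L)^2 - (V - (m.xL - L)^2 - m.fL) + m.piL * vL) := by
  have hvH : 0 < vH := hvL.trans hv
  have h := hm.2 ⟨xH, xL, V - (xH - H)^2 + pH * (vH - vL) - uH, V - (xL - L)^2 - uL, pL, pH⟩ (by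
    refine ⟨hpL, hpL1, hpH, hpH1, ?_, ?_, ?_, ?_, ?_⟩ <;> dsimp only
    · nlinarith
    · nlinarith
    · linarith
    · linarith
    · have e₁ : (1 - vL / vH) * μ0 * pH = ((vH - vL) * μ0 * pH) / vH := by field_simp
      have e₂ : (vL / vH) * (1 - μ0) * pL = (vL * (1 - μ0) * pL) / vH := by field_simp
      rw [e₁, e₂]
      gcongr)
  simp only [Phi] at h
  linarith

theorem stmt9 (L H vL vH μ0 V : ℝ) (hLH : L < H) (hvL : 0 < vL) (hv : vL < vH)
    (hμ : μ0 ∈ Set.Ioo (0:ℝ) 1) (hprior : μ0 > vL / vH) :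
    ∀ m : Mech, IsMaximizer {m' | FeasPlus L H vL vH μ0 V m'} (Phi vL vH μ0) m →
      V - (m.xL - L)^2 - m.fL = 0 ∧
      V - (m.xH - H)^2 - m.fH + m.piH * (vH - vL) = 0 := by
  obtain ⟨hμ0, hμ1⟩ := hμ
  have hvH : 0 < vH := hvL.trans hv
  have hμv : vL < μ0 * vH := (div_lt_iff₀ hvH).1 hprior
  have hδ : 0 < H - L := sub_pos.2 hLH
  have hΔ : 0 < vH - vL := sub_pos.2 hv
  intro m hm
  have key := hm.surplus_le hvL hv
  obtain ⟨hpL, hpL1, hpH, hpH1, hICH, hICL, hIRH, hIRL, hOB⟩ := hm.1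
  obtain ⟨xH, xL, fH, fL, pL, pH⟩ := m
  dsimp only at *
  replace hOB : (vH - vL) * μ0 * pH ≤ vL * (1 - μ0) * pL := by
    have e₁ : (1 - vL / vH) * μ0 * pH = ((vH - vL) * μ0 * pH) / vH := by field_simp
    have e₂ : (vL / vH) * (1 - μ0) * pL = (vL * (1 - μ0) * pL) / vH := by field_simp
    rw [e₁, e₂] at hOB
    exact (div_le_div_iff_of_pos_right hvH).1 hOB
  generalize hUL : V - (xL - L)^2 - fL = uL at *
  generalize hUH : V - (xH - H)^2 - fH + pH * (vH - vL) = uH at *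
  replace hICH : (H - L) * (2 * xL - L - H) + pL * (vH - vL) ≤ uH - uL := by
    subst hUL hUH; linarith
  replace hICL : uH - uL ≤ pH * (vH - vL) + (H - L) * (2 * xH - L - H) := by
    subst hUL hUH; linarith
  clear hUL hUH
  have huL : uL = 0 := by
    by_contra hne
    have hpos : 0 < uL := lt_of_le_of_ne hIRL (Ne.symm hne)
    rcases hIRH.lt_or_eq with hH | hH
    · have hs : 0 < min uH uL := lt_min hH hpos
      have := key xH xL (uH - min uH uL) (uL - min uH uL) pL pH hpL hpL1 hpH hpH1
        (sub_nonneg.2 (min_le_left _ _)) (sub_nonneg.2 (min_le_right _ _))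
        (by linarith) (by linarith) hOB
      linarith
    · have hb : 0 ≤ pH * (vH - vL) := by positivity
      have := key H xL 0 0 pL pH hpL hpL1 hpH hpH1 le_rfl le_rfl
        (by linarith) (by nlinarith) hOB
      nlinarith [mul_pos (sub_pos.2 hμ1) hpos, mul_nonneg hμ0.le (sq_nonneg (xH - H))]
  refine ⟨huL, ?_⟩
  subst huL
  by_contra hne
  have hpos : 0 < uH := lt_of_le_of_ne hIRH (Ne.symm hne)
  rcases hpL.lt_or_eq with hL | hL
  · have hle : pH ≤ pL := by
      have h : (vH - vL) * μ0 * pH ≤ (vH - vL) * μ0 * pL :=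
        hOB.trans (mul_le_mul_of_nonneg_right (by linarith) hpL)
      exact le_of_mul_le_mul_left h (by positivity)
    have ha : 0 < pL * (vH - vL) := by positivity
    obtain ⟨t, ht0, ht1, htu⟩ : ∃ t : ℝ, 0 < t ∧ t ≤ 1 ∧ t * (pL * (vH - vL)) ≤ uH := by
      refine ⟨min 1 (uH / (pL * (vH - vL))), lt_min one_pos (by positivity), min_le_left _ _, ?_⟩
      exact (le_div_iff₀ ha).1 (min_le_right _ _)
    have hs : 0 ≤ 1 - t := sub_nonneg.2 ht1
    have := key xH xL (uH - t * (pL * (vH - vL))) 0 ((1 - t) * pL) ((1 - t) * pH)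
      (by positivity) (by nlinarith) (by positivity) (by nlinarith) (by linarith) le_rfl
      (by linarith)
      (by nlinarith [mul_le_mul_of_nonneg_left hle (mul_pos ht0 hΔ).le])
      (by nlinarith [mul_le_mul_of_nonneg_left hOB hs])
    nlinarith [mul_pos (mul_pos ht0 hL) (sub_pos.2 hμv)]
  · subst hL
    rcases le_total (2 * xL) (L + H) with hx | hx
    · have := key xH xL 0 0 0 pH le_rfl hpL1 hpH hpH1 le_rfl le_rfl
        (by nlinarith) (by linarith) hOB
      nlinarith
    · have := key xH ((L + H) / 2) 0 0 0 pH le_rfl hpL1 hpH hpH1 le_rfl le_rfl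
        (by linarith) (by linarith) hOB
      have hsq : ((L + H) / 2 - L)^2 ≤ (xL - L)^2 :=
        pow_le_pow_left₀ (by linarith) (by linarith) 2
      nlinarith [mul_le_mul_of_nonneg_left hsq (sub_pos.2 hμ1).le, mul_pos hμ0 hpos]
end

section
/- Fix reals L, H with δ := H − L > 0, reals 0 < v_L < v_H with Δv := v_H − v_L, μ0 ∈ (0,1) with μ0 < v_L/v_H, and a real V. Then every maximizer m = (x_H, x_L, f_H, f_L, πL, πH) of Ψ over the small-prior feasible set F⁻ satisfies both participation constraints with equality: V − (x_L−L)² − f_L = 0 and V − (x_H−H)² − f_H + πH·Δv = Δv. -/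
theorem stmt10 (L H vL vH μ0 V : ℝ) (hLH : L < H) (hvL : 0 < vL) (hv : vL < vH)
    (hμ : μ0 ∈ Set.Ioo (0:ℝ) 1) (hprior : μ0 < vL / vH) :
    ∀ m : Mech, IsMaximizer {m' | FeasMinus L H vL vH μ0 V m'} (Psi vL vH μ0) m →
      V - (m.xL - L)^2 - m.fL = 0 ∧
      V - (m.xH - H)^2 - m.fH + m.piH * (vH - vL) = vH - vL := by
  rintro m ⟨⟨_, hL1, _, _, _, _, hIRH, hIRL, _⟩, hmax⟩
  obtain ⟨hμ0, hμ1⟩ := hμ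
  have hfeas : FeasMinus L H vL vH μ0 V ⟨H, L, V, V, 1, 1⟩ := by
    refine ⟨zero_le_one, le_rfl, zero_le_one, le_rfl, ?_, ?_, ?_, ?_, ?_⟩ <;>
      dsimp only <;> nlinarith [sq_nonneg (L - H)]
  have hval := hmax _ hfeas
  simp only [Psi] at hval
  have hμ1' : 0 < 1 - μ0 := sub_pos.mpr hμ1
  have hpi := mul_nonneg (mul_nonneg hμ1'.le hvL.le) (sub_nonneg.mpr hL1)
  have hxH := mul_nonneg hμ0.le (sq_nonneg (m.xH - H))
  have hxL := mul_nonneg hμ1'.le (sq_nonneg (m.xL - L))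
  have hrentH := mul_nonneg hμ0.le (sub_nonneg.mpr hIRH)
  have hrentL := mul_nonneg hμ1'.le hIRL
  constructor
  · refine le_antisymm (le_of_mul_le_mul_left ?_ hμ1') hIRL
    linarith
  · refine le_antisymm (le_of_mul_le_mul_left ?_ hμ0) hIRH
    linarith
end

section
/- Fix reals L, H with δ := H − L > 0, reals 0 < v_L < v_H with Δv := v_H − v_L, μ0 ∈ (0,1) with μ0 > v_L/v_H, and a real V. Then every maximizer m = (x_H, x_L, f_H, f_L, πL, πH) of Φ over the large-prior feasible set F⁺ satisfies πL > πH. In particular, no optimal mechanism has πL = πH, i.e., the null-information (full-privacy) disclosure policy is never optimal. -/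
/-- Under the large prior, obedience forces `piH < piL` unless both probabilities vanish. -/
lemma FeasPlus.piL_eq_zero_and_piH_eq_zero {L H vL vH μ0 V : ℝ} {m : Mech}
    (hm : FeasPlus L H vL vH μ0 V m) (hvL : 0 < vL) (hv : vL < vH) (hμ : μ0 < 1)
    (hprior : vL / vH < μ0) (hle : m.piL ≤ m.piH) : m.piL = 0 ∧ m.piH = 0 := by
  obtain ⟨hL0, -, -, -, -, -, -, -, hOB⟩ := hm
  have hr : 0 < vL / vH := div_pos hvL (hvL.trans hv)
  have hmono : vL / vH * (1 - μ0) * m.piL ≤ vL / vH * (1 - μ0) * m.piH :=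
    mul_le_mul_of_nonneg_left hle (mul_nonneg hr.le (sub_nonneg.2 hμ.le))
  have hprod : (μ0 - vL / vH) * m.piH ≤ 0 := by linarith
  have hH : m.piH ≤ 0 := nonpos_of_mul_nonpos_right hprod (sub_pos.2 hprior)
  constructor <;> linarith

/-- Without disclosure, the participation constraints bound the objective by `V`. -/
lemma FeasPlus.phi_le_of_pi_eq_zero {L H vL vH μ0 V : ℝ} {m : Mech}
    (hm : FeasPlus L H vL vH μ0 V m) (hμ : μ0 ∈ Set.Ioo (0 : ℝ) 1)
    (hL : m.piL = 0) (hH : m.piH = 0) : Phi vL vH μ0 m ≤ V := by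
  obtain ⟨-, -, -, -, -, -, hIRH, hIRL, -⟩ := hm
  rw [hH] at hIRH
  have hfH : m.fH ≤ V := by nlinarith [sq_nonneg (m.xH - H)]
  have hfL : m.fL ≤ V := by nlinarith [sq_nonneg (m.xL - L)]
  rw [Phi, hL, hH]
  linarith [mul_le_mul_of_nonneg_left hfH hμ.1.le,
    mul_le_mul_of_nonneg_left hfL (sub_nonneg.2 hμ.2.le)]

/-- Efficient provision at fees `V` stays feasible when the low type is recommended the low price
with a probability `ε` whose value to the high type is at most the slack `(H - L) ^ 2`. -/
lemma feasPlus_efficient {L H vL vH μ0 V ε : ℝ} (hvL : 0 < vL) (hv : vL < vH) (hμ : μ0 < 1)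
    (hε : 0 ≤ ε) (hε1 : ε ≤ 1) (hslack : ε * (vH - vL) ≤ (H - L) ^ 2) :
    FeasPlus L H vL vH μ0 V ⟨H, L, V, V, ε, 0⟩ := by
  have hr : 0 < vL / vH := div_pos hvL (hvL.trans hv)
  have hOB : 0 ≤ vL / vH * (1 - μ0) * ε :=
    mul_nonneg (mul_nonneg hr.le (sub_nonneg.2 hμ.le)) hε
  refine ⟨hε, hε1, le_rfl, zero_le_one, ?_, ?_, ?_, ?_, ?_⟩ <;> dsimp only <;>
    nlinarith [sq_nonneg (H - L)]

theorem stmt11 (L H vL vH μ0 V : ℝ) (hLH : L < H) (hvL : 0 < vL) (hv : vL < vH)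
    (hμ : μ0 ∈ Set.Ioo (0:ℝ) 1) (hprior : μ0 > vL / vH) :
    ∀ m : Mech, IsMaximizer {m' | FeasPlus L H vL vH μ0 V m'} (Phi vL vH μ0) m →
      m.piL > m.piH := by
  intro m hm
  by_contra! hle
  obtain ⟨hL, hH⟩ := hm.1.piL_eq_zero_and_piH_eq_zero hvL hv hμ.2 hprior hle
  have hΔ : 0 < vH - vL := sub_pos.2 hv
  have hδ : 0 < (H - L) ^ 2 := pow_pos (sub_pos.2 hLH) 2
  set ε := min 1 ((H - L) ^ 2 / (vH - vL))
  have hε : 0 < ε := lt_min one_pos (div_pos hδ hΔ)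
  have hslack : ε * (vH - vL) ≤ (H - L) ^ 2 := (le_div_iff₀ hΔ).1 (min_le_right _ _)
  have hopt := hm.2 _ (feasPlus_efficient (V := V) hvL hv hμ.2 hε.le (min_le_left _ _) hslack)
  have hbound := hm.1.phi_le_of_pi_eq_zero hμ hL hH
  have hgain : 0 < (1 - μ0) * ε * vL := mul_pos (mul_pos (sub_pos.2 hμ.2) hε) hvL
  have hval : Phi vL vH μ0 ⟨H, L, V, V, ε, 0⟩ = V + (1 - μ0) * ε * vL := by
    simp only [Phi]; ring
  linarith
end

section
/- Fix reals L, H with δ := H − L > 0, reals 0 < v_L < v_H with Δv := v_H − v_L, μ0 ∈ (0,1) with μ0 < v_L/v_H, and a real V. Then the mechanism m = (x_H, x_L, f_H, f_L, πL, πH) = (H, L, V, V, 1, 1) belongs to the small-prior feasible set F⁻ and is a maximizer of Ψ over F⁻, with Ψ(m) = V. In particular, a null-information (full-privacy) disclosure policy, with πL = πH, is optimal when μ0 < v_L/v_H. -/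
theorem stmt12 (L H vL vH μ0 V : ℝ) (hLH : L < H) (hvL : 0 < vL) (hv : vL < vH)
    (hμ : μ0 ∈ Set.Ioo (0:ℝ) 1) (hprior : μ0 < vL / vH) :
    FeasMinus L H vL vH μ0 V ⟨H, L, V, V, 1, 1⟩ ∧
    IsMaximizer {m' | FeasMinus L H vL vH μ0 V m'} (Psi vL vH μ0) ⟨H, L, V, V, 1, 1⟩ ∧
    Psi vL vH μ0 ⟨H, L, V, V, 1, 1⟩ = V := by
  obtain ⟨hμ₀, hμ₁⟩ := hμ
  have hfeas : FeasMinus L H vL vH μ0 V ⟨H, L, V, V, 1, 1⟩ := by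
    refine ⟨by norm_num, by norm_num, by norm_num, by norm_num, ?_, ?_, ?_, ?_, ?_⟩
    · nlinarith [sq_nonneg (L - H)]
    · nlinarith [sq_nonneg (H - L)]
    · simp
    · simp
    · apply le_of_eq
      ring
  have hval : Psi vL vH μ0 ⟨H, L, V, V, 1, 1⟩ = V := by
    simp only [Psi]
    ring
  refine ⟨hfeas, ⟨hfeas, ?_⟩, hval⟩
  rintro m ⟨-, hpiL, -, -, -, -, hIRH, hIRL, -⟩
  rw [hval]
  have hfH : m.fH ≤ V + m.piH * (vH - vL) - (vH - vL) := by
    linarith [sq_nonneg (m.xH - H)]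
  have hfL : m.fL ≤ V := by linarith [sq_nonneg (m.xL - L)]
  have hH := mul_le_mul_of_nonneg_left hfH hμ₀.le
  have hL := mul_le_mul_of_nonneg_left hfL (sub_nonneg.2 hμ₁.le)
  have hloss : 0 ≤ (1 - μ0) * (1 - m.piL) * vL :=
    mul_nonneg (mul_nonneg (sub_nonneg.2 hμ₁.le) (sub_nonneg.2 hpiL)) hvL.le
  simp only [Psi]
  linarith
end

section
/- Fix reals L, H with δ := H − L > 0, reals 0 < v_L < v_H with Δv := v_H − v_L, μ0 ∈ (0,1) with μ0 > v_L/v_H, and a real V. Then there exists a maximizer of Φ over the large-prior feasible set F⁺ whose disclosure policy is full information, i.e., with πL = 1 and πH = 0, if and only if δ²·(v_L + v_H) ≥ (Δv)². -/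
/-- Weighting (IC_H), (IR_H) and (IR_L) by `(1 - μ0) * k`, `μ0 - (1 - μ0) * k` and
`1 - μ0 + (1 - μ0) * k` completes the squares in the service provisions. -/
lemma phi_add_weighted_slacks (L H vL vH μ0 V k : ℝ) (m : Mech) :
    Phi vL vH μ0 m
      + (1 - μ0) * k * ((-(m.xH - H)^2 - m.fH + m.piH * (vH - vL))
          - (-(m.xL - H)^2 - m.fL + m.piL * (vH - vL)))
      + (μ0 - (1 - μ0) * k) * (V - (m.xH - H)^2 - m.fH + m.piH * (vH - vL))
      + (1 - μ0 + (1 - μ0) * k) * (V - (m.xL - L)^2 - m.fL)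
      + (1 - μ0) * (m.xL - L + (H - L) * k)^2 + μ0 * (m.xH - H)^2
    = V + (1 - μ0) * ((H - L)^2 * k^2 + (H - L)^2 * k + m.piL * (vL - k * (vH - vL))) := by
  unfold Phi
  ring

/-- The mechanism serving the high type efficiently at fee `V` without disclosure,
and distorting the low type's provision downward by `(H - L) * k`. -/
def distortedMech (L H V k p : ℝ) : Mech :=
  ⟨H, L - (H - L) * k, V, V - ((H - L) * k)^2, p, 0⟩

lemma phi_distortedMech (L H vL vH μ0 V k p : ℝ) :
    Phi vL vH μ0 (distortedMech L H V k p)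
      = V + (1 - μ0) * (p * vL - ((H - L) * k)^2) := by
  simp only [Phi, distortedMech]
  ring

lemma feasPlus_distortedMech {L H vL vH μ0 : ℝ} (V : ℝ) {k p : ℝ} (hvL : 0 < vL) (hv : vL < vH)
    (hμ : μ0 < 1) (hp0 : 0 ≤ p) (hp1 : p ≤ 1)
    (hIC : p * (vH - vL) ≤ (H - L)^2 * (1 + 2 * k)) :
    FeasPlus L H vL vH μ0 V (distortedMech L H V k p) := by
  have hvH : 0 < vH := hvL.trans hv
  have hOB : 0 ≤ vL / vH * (1 - μ0) * p :=
    mul_nonneg (mul_nonneg (by positivity) (by linarith)) hp0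
  refine ⟨hp0, hp1, le_rfl, zero_le_one, ?_, ?_, ?_, ?_, ?_⟩ <;> simp only [distortedMech]
  · nlinarith
  · nlinarith [sq_nonneg (H - L)]
  · nlinarith
  · nlinarith
  · linarith

lemma isMaximizer_distortedMech {L H vL vH μ0 : ℝ} (V : ℝ) {k : ℝ} (hvL : 0 < vL) (hv : vL < vH)
    (hμ0 : 0 < μ0) (hμ1 : μ0 < 1) (hk : 0 ≤ k) (hkμ : (1 - μ0) * k ≤ μ0)
    (hkv : k * (vH - vL) ≤ vL) (hIC : vH - vL ≤ (H - L)^2 * (1 + 2 * k))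
    (hslack : k * ((H - L)^2 * (1 + 2 * k) - (vH - vL)) = 0) :
    IsMaximizer {m' | FeasPlus L H vL vH μ0 V m'} (Phi vL vH μ0) (distortedMech L H V k 1) := by
  refine ⟨feasPlus_distortedMech V hvL hv hμ1 zero_le_one le_rfl (by linarith), ?_⟩
  rintro m ⟨-, hp1, -, -, hICH, -, hIRH, hIRL, -⟩
  have hid := phi_add_weighted_slacks L H vL vH μ0 V k m
  have hν : 0 ≤ 1 - μ0 := by linarith
  have h1 := mul_nonneg (mul_nonneg hν hk) (sub_nonneg.2 hICH)
  have h2 := mul_nonneg (sub_nonneg.2 hkμ) hIRH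
  have h3 := mul_nonneg (add_nonneg hν (mul_nonneg hν hk)) hIRL
  have h4 := mul_nonneg hν (sq_nonneg (m.xL - L + (H - L) * k))
  have h5 := mul_nonneg hμ0.le (sq_nonneg (m.xH - H))
  have h6 := mul_nonneg hν (mul_nonneg (sub_nonneg.2 hp1) (sub_nonneg.2 hkv))
  rw [phi_distortedMech]
  linear_combination h1 + h2 + h3 + h4 + h5 + h6 + hid + (1 - μ0) * hslack

theorem stmt13 (L H vL vH μ0 V : ℝ) (hLH : L < H) (hvL : 0 < vL) (hv : vL < vH)
    (hμ : μ0 ∈ Set.Ioo (0:ℝ) 1) (hprior : μ0 > vL / vH) :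
    (∃ m : Mech, IsMaximizer {m' | FeasPlus L H vL vH μ0 V m'} (Phi vL vH μ0) m ∧
        m.piL = 1 ∧ m.piH = 0) ↔
      (H - L)^2 * (vL + vH) ≥ (vH - vL)^2 := by
  obtain ⟨hμ0, hμ1⟩ := hμ
  have hD : 0 < vH - vL := sub_pos.2 hv
  have hδ : 0 < (H - L)^2 := pow_pos (sub_pos.2 hLH) 2
  have hν : 0 < 1 - μ0 := sub_pos.2 hμ1
  have hμv : (1 - μ0) * vL < μ0 * (vH - vL) := by
    have := (div_lt_iff₀ (hvL.trans hv)).1 hprior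
    linarith
  constructor
  · rintro ⟨m, ⟨⟨-, -, -, -, hICH, -, hIRH, hIRL, -⟩, hmax⟩, hpL, hpH⟩
    by_contra! hlt
    obtain ⟨k, hkD⟩ : ∃ k, k * (vH - vL) = vL := ⟨vL / (vH - vL), by field_simp⟩
    have hk : 0 < k := pos_of_mul_pos_left (hvL.trans_eq hkD.symm) hD.le
    have hkμ : (1 - μ0) * k < μ0 := by
      refine lt_of_mul_lt_mul_right ?_ hD.le
      rwa [mul_assoc, hkD]
    obtain ⟨p, hp⟩ : ∃ p, p * (vH - vL) = (H - L)^2 * (1 + 2 * k) :=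
      ⟨(H - L)^2 * (1 + 2 * k) / (vH - vL), by field_simp⟩
    have hgap : (H - L)^2 * (1 + 2 * k) < vH - vL := by
      refine lt_of_mul_lt_mul_right ?_ hD.le
      linear_combination hlt + 2 * (H - L)^2 * hkD
    have hp0 : 0 ≤ p := nonneg_of_mul_nonneg_left (hp ▸ by positivity) hD
    have hp1 : p ≤ 1 := by
      refine le_of_mul_le_mul_right ?_ hD
      linarith
    have hle := hmax _ (feasPlus_distortedMech V hvL hv hμ1 hp0 hp1 hp.le)
    rw [phi_distortedMech] at hle
    have hid := phi_add_weighted_slacks L H vL vH μ0 V k m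
    have h1 := mul_nonneg (mul_pos hν hk).le (sub_nonneg.2 hICH)
    have h2 := mul_nonneg (sub_pos.2 hkμ).le hIRH
    have h3 := mul_nonneg (add_pos hν (mul_pos hν hk)).le hIRL
    have h4 := mul_nonneg hν.le (sq_nonneg (m.xL - L + (H - L) * k))
    have h5 := mul_nonneg hμ0.le (sq_nonneg (m.xH - H))
    have hval : (H - L)^2 * k^2 + (H - L)^2 * k + m.piL * (vL - k * (vH - vL))
        = p * vL - ((H - L) * k)^2 := by
      linear_combination (p - m.piL) * hkD - k * hp
    rw [hval] at hid
    have e1 := (mul_eq_zero_iff_left (mul_pos hν hk).ne').1 (le_antisymm (by linarith) h1)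
    have e2 := (mul_eq_zero_iff_left (sub_pos.2 hkμ).ne').1 (le_antisymm (by linarith) h2)
    have e3 := (mul_eq_zero_iff_left (add_pos hν (mul_pos hν hk)).ne').1
      (le_antisymm (by linarith) h3)
    have e4 := pow_eq_zero_iff two_ne_zero |>.1 <|
      (mul_eq_zero_iff_left hν.ne').1 (le_antisymm (by linarith) h4)
    have hbind : (H - L)^2 * (1 + 2 * k) = vH - vL := by
      rw [hpL] at e1
      linear_combination e1 - e2 + e3 + 2 * (H - L) * e4
    exact hgap.ne hbind
  · intro hge
    rcases le_total (vH - vL) ((H - L)^2) with h | h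
    · exact ⟨_, isMaximizer_distortedMech V (k := 0) hvL hv hμ0 hμ1 le_rfl (by linarith)
        (by linarith) (by linarith) (by ring), rfl, rfl⟩
    · obtain ⟨k, hk⟩ : ∃ k, (H - L)^2 * (1 + 2 * k) = vH - vL :=
        ⟨((vH - vL) / (H - L)^2 - 1) / 2, by
          have : H - L ≠ 0 := sub_ne_zero.2 hLH.ne'
          field_simp
          ring⟩
      have hk0 : 0 ≤ k := by
        refine le_of_mul_le_mul_left ?_ hδ
        linarith
      have hkv : k * (vH - vL) ≤ vL := by
        refine le_of_mul_le_mul_left ?_ hδ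
        linear_combination hge / 2 + (vH - vL) / 2 * hk
      have hkμ : (1 - μ0) * k ≤ μ0 := by
        refine le_of_mul_le_mul_right ?_ hD
        linarith [mul_le_mul_of_nonneg_left hkv hν.le]
      exact ⟨_, isMaximizer_distortedMech V hvL hv hμ0 hμ1 hk0 hkμ hkv hk.ge
        (by rw [hk]; ring), rfl, rfl⟩
end

section
/- Fix reals L, H with δ := H − L > 0, reals 0 < v_L < v_H with Δv := v_H − v_L, μ0 ∈ (0,1) with μ0 < v_L/v_H, and a real V. Then there exists a maximizer of Ψ over the small-prior feasible set F⁻ whose disclosure policy is full information, i.e., with πL = 1 and πH = 0, if and only if δ² ≥ Δv. -/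
theorem stmt14 (L H vL vH μ0 V : ℝ) (hLH : L < H) (hvL : 0 < vL) (hv : vL < vH)
    (hμ : μ0 ∈ Set.Ioo (0:ℝ) 1) (hprior : μ0 < vL / vH) :
    (∃ m : Mech, IsMaximizer {m' | FeasMinus L H vL vH μ0 V m'} (Psi vL vH μ0) m ∧
        m.piL = 1 ∧ m.piH = 0) ↔
      (H - L)^2 ≥ vH - vL := by
  obtain ⟨hμ_pos, hμ_lt⟩ := hμ
  have hvH : 0 < vH := hvL.trans hv
  have hr : vL / vH < 1 := (div_lt_one hvH).2 hv
  have hprod : 0 ≤ (1 - vL / vH) * μ0 := by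
    have : 0 < 1 - vL / vH := by linarith
    positivity
  constructor
  · rintro ⟨⟨xH, xL, fH, fL, piL, piH⟩, ⟨hfeas, hmax⟩, hL, hH⟩
    dsimp only at hL hH
    subst hL hH
    obtain ⟨-, -, -, -, -, hICL, hIRH, hIRL, -⟩ := hfeas
    have hle := hmax ⟨H, L, V, V, 1, 1⟩ (by
      refine ⟨?_, ?_, ?_, ?_, ?_, ?_, ?_, ?_, ?_⟩ <;> dsimp only <;>
        nlinarith [sq_nonneg (H - L)])
    simp only [Psi] at hle
    dsimp only at hICL hIRH hIRL
    have hH0 : 0 ≤ V - (vH - vL) - fH := by nlinarith [sq_nonneg (xH - H)]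
    have hL0 : 0 ≤ V - fL := by nlinarith [sq_nonneg (xL - L)]
    have hfH : fH = V - (vH - vL) := by nlinarith [mul_nonneg (sub_nonneg.2 hμ_lt.le) hL0]
    have hfL : fL = V := by nlinarith [mul_nonneg hμ_pos.le hH0]
    have hxH : xH = H := by
      have : (xH - H) ^ 2 = 0 := le_antisymm (by linarith) (sq_nonneg _)
      linarith [pow_eq_zero_iff (two_ne_zero) |>.1 this]
    subst hxH
    nlinarith [sq_nonneg (xL - L)]
  · intro hδ
    refine ⟨⟨H, L, V - (vH - vL), V, 1, 0⟩, ⟨?_, ?_⟩, rfl, rfl⟩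
    · refine ⟨?_, ?_, ?_, ?_, ?_, ?_, ?_, ?_, ?_⟩ <;> dsimp only <;>
        nlinarith [sq_nonneg (H - L)]
    · rintro ⟨xH, xL, fH, fL, piL, piH⟩ ⟨-, hpiL, -, -, -, -, hIRH, hIRL, -⟩
      dsimp only at hpiL hIRH hIRL
      simp only [Psi]
      have hH0 : 0 ≤ V - (vH - vL) + piH * (vH - vL) - fH := by
        linarith [sq_nonneg (xH - H)]
      have hL0 : 0 ≤ V - fL := by linarith [sq_nonneg (xL - L)]
      have hμ' : 0 ≤ 1 - μ0 := by linarith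
      linarith [mul_nonneg hμ_pos.le hH0, mul_nonneg hμ' hL0,
        mul_nonneg (mul_nonneg hμ' hvL.le) (sub_nonneg.2 hpiL)]
end

section
/- Fix reals L, H with δ := H − L > 0, reals 0 < v_L < v_H with Δv := v_H − v_L, μ0 ∈ (0,1) with μ0 > v_L/v_H, and a real V. If δ² ≥ Δv then the supremum of Φ over the large-prior feasible set F⁺ equals V + (1−μ0)·v_L, and if δ² < Δv then this supremum is strictly less than V + (1−μ0)·v_L. Consequently, the social welfare achieved by the intermediary's optimal mechanism, sup_{F⁺} Φ + μ0·v_H, equals the first-best welfare V + μ0·v_H + (1−μ0)·v_L if and only if δ² ≥ Δv. -/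
/-- The mechanism with efficient provisions, both fees `V`, and disclosure probability `p` for type
`L` only. -/
def efficientMech (L H V p : ℝ) : Mech := ⟨H, L, V, V, p, 0⟩

theorem feasPlus_efficientMech {L H vL vH μ0 V p : ℝ} (hvL : 0 < vL) (hv : vL < vH)
    (hμ : μ0 < 1) (hp0 : 0 ≤ p) (hp1 : p ≤ 1) (hp : p * (vH - vL) ≤ (H - L) ^ 2) :
    FeasPlus L H vL vH μ0 V (efficientMech L H V p) := by
  have hob : 0 ≤ vL / vH * (1 - μ0) * p :=
    mul_nonneg (mul_nonneg (div_pos hvL (hvL.trans hv)).le (by linarith)) hp0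
  refine ⟨hp0, hp1, le_rfl, zero_le_one, ?_, ?_, ?_, ?_, ?_⟩ <;> simp only [efficientMech] <;>
    nlinarith [sq_nonneg (H - L)]

theorem phi_le_firstBest {L H vL vH μ0 V : ℝ} (hvL : 0 < vL) (hμ0 : 0 < μ0) (hμ1 : μ0 < 1)
    {m : Mech} (hm : FeasPlus L H vL vH μ0 V m) :
    Phi vL vH μ0 m ≤ V + (1 - μ0) * vL := by
  obtain ⟨-, hp1, -, -, -, -, hH, hL, -⟩ := hm
  have hμ : 0 < 1 - μ0 := by linarith
  have hUH := mul_nonneg hμ0.le (add_nonneg hH (sq_nonneg (m.xH - H)))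
  have hUL := mul_nonneg hμ.le (add_nonneg hL (sq_nonneg (m.xL - L)))
  have hπ := mul_nonneg (mul_pos hμ hvL).le (sub_nonneg.2 hp1)
  unfold Phi
  linarith

/-- When `(H - L) ^ 2 < vH - vL`, the incentive constraint of type `H` forces a loss of at least
`k * (vH - vL - (H - L) ^ 2) / 2`, for every sufficiently small weight `k` on that constraint. -/
theorem phi_le_firstBest_sub {L H vL vH μ0 V k : ℝ} (hμ1 : μ0 < 1)
    (hk0 : 0 < k) (hkμ : k ≤ μ0) (hkv : k * (vH - vL) ≤ (1 - μ0) * vL)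
    (hkg : k * (H - L) ^ 2 ≤ (1 - μ0) * ((vH - vL - (H - L) ^ 2) / 2))
    {m : Mech} (hm : FeasPlus L H vL vH μ0 V m) :
    Phi vL vH μ0 m ≤ V + (1 - μ0) * vL - k * ((vH - vL - (H - L) ^ 2) / 2) := by
  obtain ⟨-, hp1, -, -, hIC, -, hH, hL, -⟩ := hm
  have hμ : 0 < 1 - μ0 := by linarith
  have hUH := mul_nonneg (sub_nonneg.2 hkμ) hH
  have hUL := mul_nonneg hμ.le hL
  have hxH := mul_nonneg (hk0.le.trans hkμ) (sq_nonneg (m.xH - H))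
  have hπ := mul_nonneg (sub_nonneg.2 hkv) (sub_nonneg.2 hp1)
  have hICk := mul_nonneg hk0.le (add_nonneg (sub_nonneg.2 hIC) hL)
  have hsq : -(k * ((vH - vL - (H - L) ^ 2) / 2)) ≤
      (1 - μ0) * (m.xL - L) ^ 2 + 2 * k * (m.xL - L) * (H - L) := by
    refine le_of_mul_le_mul_left ?_ hμ
    nlinarith [sq_nonneg ((1 - μ0) * (m.xL - L) + k * (H - L)),
      mul_le_mul_of_nonneg_left hkg hk0.le]
  unfold Phi
  nlinarith

theorem stmt15 (L H vL vH μ0 V : ℝ) (hLH : L < H) (hvL : 0 < vL) (hv : vL < vH)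
    (hμ : μ0 ∈ Set.Ioo (0:ℝ) 1) (hprior : μ0 > vL / vH) :
    ((H - L)^2 ≥ vH - vL →
      sSup (Phi vL vH μ0 '' {m | FeasPlus L H vL vH μ0 V m}) = V + (1 - μ0) * vL) ∧
    ((H - L)^2 < vH - vL →
      sSup (Phi vL vH μ0 '' {m | FeasPlus L H vL vH μ0 V m}) < V + (1 - μ0) * vL) ∧
    (sSup (Phi vL vH μ0 '' {m | FeasPlus L H vL vH μ0 V m}) + μ0 * vH
        = V + μ0 * vH + (1 - μ0) * vL ↔ (H - L)^2 ≥ vH - vL) := by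
  obtain ⟨hμ0, hμ1⟩ := hμ
  have hμ : 0 < 1 - μ0 := by linarith
  have hΔ : 0 < vH - vL := by linarith
  have eq_of_ge (hge : (H - L)^2 ≥ vH - vL) :
      sSup (Phi vL vH μ0 '' {m | FeasPlus L H vL vH μ0 V m}) = V + (1 - μ0) * vL := by
    refine IsGreatest.csSup_eq ⟨⟨efficientMech L H V 1, ?_, ?_⟩, ?_⟩
    · exact feasPlus_efficientMech hvL hv hμ1 zero_le_one le_rfl (by linarith)
    · simp only [Phi, efficientMech]
      ring
    · rintro _ ⟨m, hm, rfl⟩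
      exact phi_le_firstBest hvL hμ0 hμ1 hm
  have lt_of_lt (hlt : (H - L)^2 < vH - vL) :
      sSup (Phi vL vH μ0 '' {m | FeasPlus L H vL vH μ0 V m}) < V + (1 - μ0) * vL := by
    have hg : 0 < (vH - vL - (H - L) ^ 2) / 2 := by linarith
    have hδ : 0 < (H - L) ^ 2 := pow_pos (sub_pos.2 hLH) 2
    obtain ⟨k, hk0, hk⟩ : ∃ k, 0 < k ∧ k ≤ min μ0 (min ((1 - μ0) * vL / (vH - vL))
        ((1 - μ0) * ((vH - vL - (H - L) ^ 2) / 2) / (H - L) ^ 2)) :=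
      ⟨_, by positivity, le_rfl⟩
    rw [le_min_iff, le_min_iff, le_div_iff₀ hΔ, le_div_iff₀ hδ] at hk
    obtain ⟨hkμ, hkv, hkg⟩ := hk
    refine (csSup_le ?_ ?_).trans_lt (sub_lt_self _ (mul_pos hk0 hg))
    · exact ⟨_, efficientMech L H V 0,
        feasPlus_efficientMech hvL hv hμ1 le_rfl zero_le_one (by linarith), rfl⟩
    · rintro _ ⟨m, hm, rfl⟩
      exact phi_le_firstBest_sub hμ1 hk0 hkμ hkv hkg hm
  refine ⟨eq_of_ge, lt_of_lt, fun h => ?_, fun hge => ?_⟩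
  · by_contra! hlt
    linarith [lt_of_lt hlt]
  · linarith [eq_of_ge hge]
end

section
/- Fix reals L, H with δ := H − L > 0, μ0 ∈ (0,1), and a real V. Consider the no-data-trade problem: maximize μ0·f_H + (1−μ0)·f_L over tuples (x_H, x_L, f_H, f_L) ∈ ℝ⁴ satisfying (IC_H⁰): −(x_H−H)² − f_H ≥ −(x_L−H)² − f_L; (IC_L⁰): −(x_L−L)² − f_L ≥ −(x_H−L)² − f_H; (IR_H⁰): V − (x_H−H)² − f_H ≥ 0; (IR_L⁰): V − (x_L−L)² − f_L ≥ 0. The maximum value is V, and a feasible tuple is a maximizer if and only if x_H = H, x_L = L, and f_H = f_L = V. -/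
/-- Feasible set of the no-data-trade problem: a tuple `(xH, xL, fH, fL)`
satisfying both incentive-compatibility and both participation constraints. -/
def Feas0 (L H V : ℝ) (t : ℝ × ℝ × ℝ × ℝ) : Prop :=
  (-(t.1 - H)^2 - t.2.2.1 ≥ -(t.2.1 - H)^2 - t.2.2.2) ∧
  (-(t.2.1 - L)^2 - t.2.2.2 ≥ -(t.1 - L)^2 - t.2.2.1) ∧
  (V - (t.1 - H)^2 - t.2.2.1 ≥ 0) ∧
  (V - (t.2.1 - L)^2 - t.2.2.2 ≥ 0)

/-- Service revenue of the no-data-trade problem. -/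
noncomputable def Obj0 (μ0 : ℝ) (t : ℝ × ℝ × ℝ × ℝ) : ℝ :=
  μ0 * t.2.2.1 + (1 - μ0) * t.2.2.2

theorem Feas0.fees_le {L H V : ℝ} {t : ℝ × ℝ × ℝ × ℝ} (ht : Feas0 L H V t) :
    t.2.2.1 ≤ V - (t.1 - H)^2 ∧ t.2.2.2 ≤ V - (t.2.1 - L)^2 := by
  obtain ⟨-, -, hH, hL⟩ := ht
  constructor <;> linarith

theorem feas0_efficient (L H V : ℝ) : Feas0 L H V (H, L, V, V) := by
  refine ⟨?_, ?_, ?_, ?_⟩ <;> dsimp only <;> nlinarith [sq_nonneg (H - L)]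

theorem obj0_efficient (L H μ0 V : ℝ) : Obj0 μ0 (H, L, V, V) = V := by
  simp only [Obj0]
  ring

theorem Feas0.obj0_le {L H μ0 V : ℝ} (hμ : μ0 ∈ Set.Ioo (0:ℝ) 1) {t : ℝ × ℝ × ℝ × ℝ}
    (ht : Feas0 L H V t) : Obj0 μ0 t ≤ V := by
  obtain ⟨hH, hL⟩ := ht.fees_le
  have hfH : t.2.2.1 ≤ V := by linarith [sq_nonneg (t.1 - H)]
  have hfL : t.2.2.2 ≤ V := by linarith [sq_nonneg (t.2.1 - L)]
  unfold Obj0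
  nlinarith [mul_nonneg hμ.1.le (sub_nonneg.2 hfH),
    mul_nonneg (sub_nonneg.2 hμ.2.le) (sub_nonneg.2 hfL)]

theorem Feas0.eq_efficient_of_le_obj0 {L H μ0 V : ℝ} (hμ : μ0 ∈ Set.Ioo (0:ℝ) 1)
    {t : ℝ × ℝ × ℝ × ℝ} (ht : Feas0 L H V t) (hV : V ≤ Obj0 μ0 t) :
    t.1 = H ∧ t.2.1 = L ∧ t.2.2.1 = V ∧ t.2.2.2 = V := by
  obtain ⟨hH, hL⟩ := ht.fees_le
  have hfH : t.2.2.1 ≤ V := by linarith [sq_nonneg (t.1 - H)]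
  have hfL : t.2.2.2 ≤ V := by linarith [sq_nonneg (t.2.1 - L)]
  have hμ' : 0 < 1 - μ0 := sub_pos.2 hμ.2
  unfold Obj0 at hV
  have hfH' : t.2.2.1 = V := by
    refine hfH.antisymm (le_of_mul_le_mul_left ?_ hμ.1)
    linarith [mul_le_mul_of_nonneg_left hfL hμ'.le]
  have hfL' : t.2.2.2 = V := by
    refine hfL.antisymm (le_of_mul_le_mul_left ?_ hμ')
    linarith [mul_le_mul_of_nonneg_left hfH hμ.1.le]
  refine ⟨?_, ?_, hfH', hfL'⟩
  · exact sub_eq_zero.1 (pow_eq_zero_iff two_ne_zero |>.1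
      ((sq_nonneg (t.1 - H)).antisymm' (by linarith)))
  · exact sub_eq_zero.1 (pow_eq_zero_iff two_ne_zero |>.1
      ((sq_nonneg (t.2.1 - L)).antisymm' (by linarith)))

theorem stmt16 (L H μ0 V : ℝ) (hLH : L < H) (hμ : μ0 ∈ Set.Ioo (0:ℝ) 1) :
    IsGreatest (Obj0 μ0 '' {t | Feas0 L H V t}) V ∧
    ∀ t : ℝ × ℝ × ℝ × ℝ, Feas0 L H V t →
      (IsMaximizer {t' | Feas0 L H V t'} (Obj0 μ0) t ↔
        (t.1 = H ∧ t.2.1 = L ∧ t.2.2.1 = V ∧ t.2.2.2 = V)) := by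
  refine ⟨⟨⟨_, feas0_efficient L H V, obj0_efficient L H μ0 V⟩, ?_⟩, fun t ht => ⟨?_, ?_⟩⟩
  · rintro _ ⟨t, ht, rfl⟩
    exact Feas0.obj0_le hμ ht
  · rintro ⟨-, hmax⟩
    refine ht.eq_efficient_of_le_obj0 hμ ?_
    simpa only [obj0_efficient] using hmax _ (feas0_efficient L H V)
  · obtain ⟨xH, xL, fH, fL⟩ := t
    rintro ⟨rfl, rfl, rfl, h⟩
    dsimp only at h
    subst h
    refine ⟨ht, fun t' ht' => ?_⟩
    rw [obj0_efficient]
    exact Feas0.obj0_le hμ ht'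
end

section
/- Fix reals L, H with δ := H − L > 0, reals 0 < v_L < v_H with Δv := v_H − v_L, μ0 ∈ (0,1) with μ0 > v_L/v_H, and a real V. Then the supremum of Φ over the large-prior feasible set F⁺ is strictly greater than V. Since V is the intermediary's optimal profit when data trade is banned, and the producer's surplus (μ0·v_H) and consumers' surplus (zero) are the same with and without data trade, banning data trade strictly decreases social welfare when μ0 > v_L/v_H. -/
/-- By individual rationality, the objective is at most `V + vL` on F⁺. -/
theorem FeasPlus.phi_le {L H vL vH μ0 V : ℝ} {m : Mech} (hvL : 0 ≤ vL)
    (hμ0 : 0 ≤ μ0) (hμ1 : μ0 ≤ 1) (hm : FeasPlus L H vL vH μ0 V m) :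
    Phi vL vH μ0 m ≤ V + vL := by
  obtain ⟨hpL, hpL1, -, -, -, -, hIRH, hIRL, -⟩ := hm
  have hH : μ0 * (m.fH - m.piH * (vH - vL)) ≤ μ0 * V :=
    mul_le_mul_of_nonneg_left (by linarith [sq_nonneg (m.xH - H)]) hμ0
  have hL : (1 - μ0) * m.fL ≤ (1 - μ0) * V :=
    mul_le_mul_of_nonneg_left (by linarith [sq_nonneg (m.xL - L)]) (by linarith)
  have hD : (1 - μ0) * m.piL * vL ≤ 1 * vL :=
    mul_le_mul_of_nonneg_right (by nlinarith) hvL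
  unfold Phi
  linarith

/-- Serving each type its bliss point at fee `V`, and disclosing only the low type with probability
`p`, is feasible as long as the high type does not gain from misreporting. -/
theorem feasPlus_bliss {L H vL vH μ0 V p : ℝ} (hvL : 0 ≤ vL) (hvH : 0 ≤ vH) (hμ1 : μ0 ≤ 1)
    (hp0 : 0 ≤ p) (hp1 : p ≤ 1) (hp : p * (vH - vL) ≤ (H - L) ^ 2) :
    FeasPlus L H vL vH μ0 V ⟨H, L, V, V, p, 0⟩ := by
  have hOB : 0 ≤ vL / vH * (1 - μ0) * p :=
    mul_nonneg (mul_nonneg (div_nonneg hvL hvH) (sub_nonneg.2 hμ1)) hp0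
  refine ⟨hp0, hp1, le_rfl, zero_le_one, ?_, ?_, ?_, ?_, ?_⟩ <;> dsimp only <;>
    nlinarith [sq_nonneg (H - L)]

theorem stmt17 (L H vL vH μ0 V : ℝ) (hLH : L < H) (hvL : 0 < vL) (hv : vL < vH)
    (hμ : μ0 ∈ Set.Ioo (0:ℝ) 1) (hprior : μ0 > vL / vH) :
    V < sSup (Phi vL vH μ0 '' {m | FeasPlus L H vL vH μ0 V m}) := by
  obtain ⟨hμ0, hμ1⟩ := hμ
  have hΔ : 0 < vH - vL := sub_pos.2 hv
  have hδ : 0 < (H - L) ^ 2 := pow_pos (sub_pos.2 hLH) 2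
  obtain ⟨p, hp0, hp1, hp⟩ : ∃ p : ℝ, 0 < p ∧ p ≤ 1 ∧ p * (vH - vL) ≤ (H - L) ^ 2 :=
    ⟨min 1 ((H - L) ^ 2 / (vH - vL)), lt_min one_pos (div_pos hδ hΔ), min_le_left _ _,
      (le_div_iff₀ hΔ).1 (min_le_right _ _)⟩
  have hbdd : BddAbove (Phi vL vH μ0 '' {m | FeasPlus L H vL vH μ0 V m}) := by
    refine ⟨V + vL, ?_⟩
    rintro _ ⟨m, hm, rfl⟩
    exact hm.phi_le hvL.le hμ0.le hμ1.le
  refine lt_of_lt_of_le ?_ (le_csSup hbdd (Set.mem_image_of_mem _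
    (feasPlus_bliss hvL.le (hvL.trans hv).le hμ1.le hp0.le hp1 hp)))
  have hgain : 0 < (1 - μ0) * p * vL := mul_pos (mul_pos (sub_pos.2 hμ1) hp0) hvL
  unfold Phi
  linarith
end

section
/- Fix reals L, H with δ := H − L > 0, reals 0 < v_L < v_H with Δv := v_H − v_L, μ0 ∈ (0,1) with μ0 > v_L/v_H, a real V, C := ((1−μ0)·v_L)/(μ0·Δv), and a bargaining weight β ∈ (0,1). Define the β-objective Φ_β(m) := μ0·f_H + (1−μ0)·f_L + β·((1−μ0)·πL·v_L − μ0·πH·Δv). Then every maximizer of Φ_β over the large-prior feasible set F⁺ has x_H = H and: (a) if δ² ≥ Δv, then x_L = L, πL = 1 and πH = C; (b) if (Δv)²/(v_H+v_L) < δ² < Δv, then x_L = L − (Δv−δ²)/(2δ), πL = 1 and πH = C; (c) if δ² ≤ (Δv)²/(v_H+v_L), then x_L = L − δ·v_L/Δv, πL = δ²·(v_H+v_L)/(Δv)² and πH = C·πL. Moreover, the maximum of Φ_β over F⁺ equals, in cases (a), (b), (c) respectively, V + (1−μ0)·v_L, V + (1−μ0)·v_L − (1−μ0)·((Δv−δ²)/(2δ))²,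 and V + (1−μ0)·(δ/Δv)²·v_L·v_H, and is therefore independent of β and equal to the maximum of the β = 1 objective Φ over F⁺. -/
/-- The intermediary's objective with bargaining weight `β` over the data-trade
surplus, in the large-prior case. -/
noncomputable def PhiB (vL vH μ0 β : ℝ) (m : Mech) : ℝ :=
  μ0 * m.fH + (1 - μ0) * m.fL +
    β * ((1 - μ0) * m.piL * vL - μ0 * m.piH * (vH - vL))

/-- The obedience constraint with denominators cleared. -/
lemma FeasPlus.obedience {L H vL vH μ0 V : ℝ} {m : Mech} (hvL : 0 < vL) (hv : vL < vH)
    (hm : FeasPlus L H vL vH μ0 V m) :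
    μ0 * m.piH * (vH - vL) ≤ (1 - μ0) * m.piL * vL := by
  obtain ⟨-, -, -, -, -, -, -, -, hOB⟩ := hm
  have hvH : 0 < vH := hvL.trans hv
  have h := mul_le_mul_of_nonneg_left hOB hvH.le
  have e1 : vH * ((1 - vL / vH) * μ0 * m.piH) = μ0 * m.piH * (vH - vL) := by
    field_simp
  have e2 : vH * ((vL / vH) * (1 - μ0) * m.piL) = (1 - μ0) * m.piL * vL := by
    field_simp
  rwa [e1, e2] at h

/-- Complementary-slackness data certifying that the distortion `y` and disclosure probability `p`
are optimal, with multiplier `l` on the constraint `(H - L)² + 2 (H - L) y ≥ p (vH - vL)`. -/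
structure DualCertificate (L H vL vH μ0 y p l : ℝ) : Prop where
  nonneg : 0 ≤ l
  lt_prior : l < μ0
  prob_nonneg : 0 ≤ p
  prob_le_one : p ≤ 1
  stationary : l * (H - L) = (1 - μ0) * y
  primal : p * (vH - vL) ≤ (H - L) ^ 2 + 2 * (H - L) * y
  slack : l * ((H - L) ^ 2 + 2 * (H - L) * y - p * (vH - vL)) = 0
  reduced_nonneg : 0 ≤ (1 - μ0) * vL - l * (vH - vL)
  reduced_slack : ((1 - μ0) * vL - l * (vH - vL)) * (1 - p) = 0

namespace DualCertificate

variable {L H vL vH μ0 V y p l β : ℝ}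

/-- Weak duality: the certified value exceeds `Phi` by at least a sum of nonnegative slacks. -/
lemma Phi_add_le (c : DualCertificate L H vL vH μ0 y p l) (hμ : μ0 < 1) {m : Mech}
    (hm : FeasPlus L H vL vH μ0 V m) :
    Phi vL vH μ0 m + μ0 * (m.xH - H) ^ 2 + (1 - μ0) * (m.xL - (L - y)) ^ 2
      + ((1 - μ0) * vL - l * (vH - vL)) * (1 - m.piL)
      + l * (V + ((m.xL - H) ^ 2 - (m.xL - L) ^ 2 - m.piL * (vH - vL))
          - (m.xH - H) ^ 2 - (m.fH - m.piH * (vH - vL)))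
      + (μ0 - l) * (V - (m.xH - H) ^ 2 - (m.fH - m.piH * (vH - vL)))
      ≤ V + (1 - μ0) * (p * vL - y ^ 2) := by
  obtain ⟨-, -, -, -, -, -, -, hIRL, -⟩ := hm
  have h := mul_nonneg (sub_nonneg.2 hμ.le) hIRL
  unfold Phi
  linear_combination h - (2 * (m.xL - L) + 2 * y) * c.stationary + c.slack + c.reduced_slack

lemma slacks_nonneg (c : DualCertificate L H vL vH μ0 y p l) (hμ : μ0 < 1) {m : Mech}
    (hm : FeasPlus L H vL vH μ0 V m) :
    0 ≤ μ0 * (m.xH - H) ^ 2 ∧ 0 ≤ (1 - μ0) * (m.xL - (L - y)) ^ 2 ∧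
      0 ≤ ((1 - μ0) * vL - l * (vH - vL)) * (1 - m.piL) ∧
      0 ≤ l * (V + ((m.xL - H) ^ 2 - (m.xL - L) ^ 2 - m.piL * (vH - vL))
          - (m.xH - H) ^ 2 - (m.fH - m.piH * (vH - vL))) ∧
      0 ≤ (μ0 - l) * (V - (m.xH - H) ^ 2 - (m.fH - m.piH * (vH - vL))) := by
  obtain ⟨-, hpL, -, -, hICH, -, hIRH, hIRL, -⟩ := hm
  refine ⟨mul_nonneg (c.nonneg.trans c.lt_prior.le) (sq_nonneg _),
    mul_nonneg (sub_nonneg.2 hμ.le) (sq_nonneg _),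
    mul_nonneg c.reduced_nonneg (sub_nonneg.2 hpL),
    mul_nonneg c.nonneg ?_, mul_nonneg (sub_nonneg.2 c.lt_prior.le) ?_⟩ <;> linarith

lemma isGreatest (c : DualCertificate L H vL vH μ0 y p l) (hvL : 0 < vL)
    (hv : vL < vH) (hμ : μ0 < 1) (hprior : vL / vH < μ0) (hβ : β ≤ 1) :
    IsGreatest (PhiB vL vH μ0 β '' {m | FeasPlus L H vL vH μ0 V m})
      (V + (1 - μ0) * (p * vL - y ^ 2)) := by
  have hvH : 0 < vH := hvL.trans hv
  have hμ0 : 0 < μ0 := c.nonneg.trans_lt c.lt_prior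
  have hD : 0 < vH - vL := sub_pos.2 hv
  have hμD : 0 < μ0 * (vH - vL) := mul_pos hμ0 hD
  have hC0 : 0 ≤ (1 - μ0) * vL / (μ0 * (vH - vL)) :=
    div_nonneg (mul_nonneg (sub_nonneg.2 hμ.le) hvL.le) hμD.le
  have hC1 : (1 - μ0) * vL / (μ0 * (vH - vL)) ≤ 1 := by
    rw [div_le_one hμD]
    linarith [(div_lt_iff₀ hvH).1 hprior]
  set q : ℝ := (1 - μ0) * vL / (μ0 * (vH - vL)) * p with hq
  have hqp : μ0 * q * (vH - vL) = (1 - μ0) * p * vL := by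
    rw [hq]
    field_simp [hD.ne']
  have hq0 : 0 ≤ q := mul_nonneg hC0 c.prob_nonneg
  refine ⟨⟨⟨H, L - y, V + q * (vH - vL), V - y ^ 2, p, q⟩,
    ⟨c.prob_nonneg, c.prob_le_one, hq0, mul_le_one₀ hC1 c.prob_nonneg c.prob_le_one,
      ?_, ?_, ?_, ?_, ?_⟩, ?_⟩, ?_⟩
  · dsimp only
    linarith [c.primal]
  · dsimp only
    linarith [mul_nonneg hq0 hD.le, sq_nonneg (H - L)]
  · dsimp only
    linarith
  · dsimp only
    linarith
  · dsimp only
    refine le_of_eq ?_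
    field_simp
    linarith
  · simp only [PhiB]
    linear_combination (1 - β) * hqp
  · rintro _ ⟨m, hm, rfl⟩
    have h := c.Phi_add_le hμ hm
    obtain ⟨h1, h2, h3, h4, h5⟩ := c.slacks_nonneg hμ hm
    have h6 := mul_nonneg (sub_nonneg.2 hβ) (sub_nonneg.2 (hm.obedience hvL hv))
    unfold Phi at h
    unfold PhiB
    linarith

lemma eq_of_isMaximizer (c : DualCertificate L H vL vH μ0 y p l) (hvL : 0 < vL)
    (hv : vL < vH) (hμ : μ0 < 1) (hprior : vL / vH < μ0) (hβ : β < 1) {m : Mech}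
    (hmax : IsMaximizer {m' | FeasPlus L H vL vH μ0 V m'} (PhiB vL vH μ0 β) m) :
    m.xH = H ∧ m.xL = L - y ∧ ((1 - μ0) * vL - l * (vH - vL)) * (1 - m.piL) = 0 ∧
      l * ((H - L) ^ 2 + 2 * (H - L) * y - m.piL * (vH - vL)) = 0 ∧
      m.piH = (1 - μ0) * vL / (μ0 * (vH - vL)) * m.piL := by
  obtain ⟨hm, hle⟩ := hmax
  obtain ⟨m₀, hm₀, he⟩ := (c.isGreatest (V := V) hvL hv hμ hprior hβ.le).1
  have hval := hle m₀ hm₀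
  rw [he] at hval
  have hμ0 : 0 < μ0 := c.nonneg.trans_lt c.lt_prior
  have hD : 0 < vH - vL := sub_pos.2 hv
  have h := c.Phi_add_le hμ hm
  obtain ⟨h1, h2, h3, h4, h5⟩ := c.slacks_nonneg hμ hm
  have hob := sub_nonneg.2 (FeasPlus.obedience hvL hv hm)
  have h6 := mul_nonneg (sub_nonneg.2 hβ.le) hob
  have hPhi : Phi vL vH μ0 m = PhiB vL vH μ0 β m
      + (1 - β) * ((1 - μ0) * m.piL * vL - μ0 * m.piH * (vH - vL)) := by
    unfold Phi PhiB
    ring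
  have e1 : μ0 * (m.xH - H) ^ 2 = 0 := by linarith
  have e2 : (1 - μ0) * (m.xL - (L - y)) ^ 2 = 0 := by linarith
  have e4 : l * (V + ((m.xL - H) ^ 2 - (m.xL - L) ^ 2 - m.piL * (vH - vL))
      - (m.xH - H) ^ 2 - (m.fH - m.piH * (vH - vL))) = 0 := by linarith
  have e5 : (μ0 - l) * (V - (m.xH - H) ^ 2 - (m.fH - m.piH * (vH - vL))) = 0 := by linarith
  have e6 : (1 - β) * ((1 - μ0) * m.piL * vL - μ0 * m.piH * (vH - vL)) = 0 := by linarith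
  have hxL : m.xL = L - y :=
    sub_eq_zero.1 (pow_eq_zero_iff two_ne_zero |>.1
      ((mul_eq_zero.1 e2).resolve_left (sub_pos.2 hμ).ne'))
  refine ⟨sub_eq_zero.1 (pow_eq_zero_iff two_ne_zero |>.1
    ((mul_eq_zero.1 e1).resolve_left hμ0.ne')), hxL, by linarith, ?_, ?_⟩
  · have e5' := (mul_eq_zero.1 e5).resolve_left (sub_pos.2 c.lt_prior).ne'
    rw [hxL] at e4
    linear_combination e4 - l * e5'
  · have e6' := (mul_eq_zero.1 e6).resolve_left (sub_pos.2 hβ).ne'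
    field_simp
    linarith

end DualCertificate

lemma PhiB_one (vL vH μ0 : ℝ) : PhiB vL vH μ0 1 = Phi vL vH μ0 := by
  funext m
  unfold PhiB Phi
  ring

section Cases

variable {L H vL vH μ0 : ℝ}

lemma dualCertificate_of_large (hvL : 0 < vL) (hμ : μ0 ∈ Set.Ioo (0 : ℝ) 1)
    (h : vH - vL ≤ (H - L) ^ 2) : DualCertificate L H vL vH μ0 0 1 0 where
  nonneg := le_rfl
  lt_prior := hμ.1
  prob_nonneg := zero_le_one
  prob_le_one := le_rfl
  stationary := by ring
  primal := by linarith
  slack := by ring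
  reduced_nonneg := by linarith [mul_nonneg (sub_nonneg.2 hμ.2.le) hvL.le]
  reduced_slack := by ring

/-- The multiplier in the intermediate regime is below the threshold for full disclosure. -/
lemma middle_multiplier_lt (hLH : L < H) (hvL : 0 < vL) (hv : vL < vH) (hμ : μ0 < 1)
    (h : (vH - vL) ^ 2 / (vH + vL) < (H - L) ^ 2) :
    (1 - μ0) * (((vH - vL) - (H - L) ^ 2) / (2 * (H - L))) / (H - L) * (vH - vL)
      < (1 - μ0) * vL := by
  have hd : 0 < H - L := sub_pos.2 hLH
  have h' := (div_lt_iff₀ (by linarith)).1 h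
  have e : (1 - μ0) * (((vH - vL) - (H - L) ^ 2) / (2 * (H - L))) / (H - L) * (vH - vL)
      = (1 - μ0) * (((vH - vL) - (H - L) ^ 2) * (vH - vL) / (2 * (H - L) ^ 2)) := by
    field_simp
  rw [e]
  refine mul_lt_mul_of_pos_left ?_ (sub_pos.2 hμ)
  rw [div_lt_iff₀ (by positivity)]
  linarith

/-- Under a large prior, a multiplier compatible with disclosure lies below the prior. -/
lemma multiplier_lt_prior {l : ℝ} (hvL : 0 < vL) (hv : vL < vH) (hprior : vL / vH < μ0)
    (h : l * (vH - vL) ≤ (1 - μ0) * vL) : l < μ0 := by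
  have := (div_lt_iff₀ (hvL.trans hv)).1 hprior
  exact lt_of_mul_lt_mul_right (by linarith) (sub_pos.2 hv).le

lemma dualCertificate_of_middle (hLH : L < H) (hvL : 0 < vL) (hv : vL < vH)
    (hμ : μ0 < 1) (hprior : vL / vH < μ0)
    (h1 : (vH - vL) ^ 2 / (vH + vL) < (H - L) ^ 2) (h2 : (H - L) ^ 2 < vH - vL) :
    DualCertificate L H vL vH μ0 (((vH - vL) - (H - L) ^ 2) / (2 * (H - L))) 1
      ((1 - μ0) * (((vH - vL) - (H - L) ^ 2) / (2 * (H - L))) / (H - L)) := by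
  have hd : 0 < H - L := sub_pos.2 hLH
  have hl := middle_multiplier_lt hLH hvL hv hμ h1
  have hy : 2 * (H - L) * (((vH - vL) - (H - L) ^ 2) / (2 * (H - L)))
      = (vH - vL) - (H - L) ^ 2 := by field_simp
  exact
    { nonneg := div_nonneg (mul_nonneg (sub_nonneg.2 hμ.le)
        (div_nonneg (by linarith) (by linarith))) hd.le
      lt_prior := multiplier_lt_prior hvL hv hprior hl.le
      prob_nonneg := zero_le_one
      prob_le_one := le_rfl
      stationary := div_mul_cancel₀ _ hd.ne'
      primal := by linarith
      slack := by rw [hy]; ring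
      reduced_nonneg := by linarith
      reduced_slack := by ring }

lemma dualCertificate_of_small (hvL : 0 < vL) (hv : vL < vH)
    (hμ : μ0 < 1) (hprior : vL / vH < μ0)
    (h : (H - L) ^ 2 ≤ (vH - vL) ^ 2 / (vH + vL)) :
    DualCertificate L H vL vH μ0 ((H - L) * vL / (vH - vL))
      ((H - L) ^ 2 * (vH + vL) / (vH - vL) ^ 2) ((1 - μ0) * vL / (vH - vL)) := by
  have hD : 0 < vH - vL := sub_pos.2 hv
  have hS : 0 < vH + vL := by linarith
  have hl : (1 - μ0) * vL / (vH - vL) * (vH - vL) = (1 - μ0) * vL := div_mul_cancel₀ _ hD.ne'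
  have hp : (H - L) ^ 2 + 2 * (H - L) * ((H - L) * vL / (vH - vL))
      = (H - L) ^ 2 * (vH + vL) / (vH - vL) ^ 2 * (vH - vL) := by
    field_simp
    ring
  exact
    { nonneg := div_nonneg (mul_nonneg (sub_nonneg.2 hμ.le) hvL.le) hD.le
      lt_prior := multiplier_lt_prior hvL hv hprior hl.le
      prob_nonneg := by positivity
      prob_le_one := (div_le_one (by positivity)).2 ((le_div_iff₀ hS).1 h)
      stationary := by ring
      primal := hp.ge
      slack := by rw [hp]; ring
      reduced_nonneg := by rw [hl, sub_self]
      reduced_slack := by rw [hl]; ring }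

end Cases

theorem stmt18 (L H vL vH μ0 V β : ℝ) (hLH : L < H) (hvL : 0 < vL) (hv : vL < vH)
    (hμ : μ0 ∈ Set.Ioo (0:ℝ) 1) (hprior : μ0 > vL / vH) (hβ : β ∈ Set.Ioo (0:ℝ) 1) :
    (∀ m : Mech, IsMaximizer {m' | FeasPlus L H vL vH μ0 V m'} (PhiB vL vH μ0 β) m →
      m.xH = H) ∧
    ((H - L)^2 ≥ vH - vL →
      (∀ m : Mech, IsMaximizer {m' | FeasPlus L H vL vH μ0 V m'} (PhiB vL vH μ0 β) m →
        m.xL = L ∧ m.piL = 1 ∧ m.piH = (1 - μ0) * vL / (μ0 * (vH - vL))) ∧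
      IsGreatest (PhiB vL vH μ0 β '' {m | FeasPlus L H vL vH μ0 V m})
        (V + (1 - μ0) * vL) ∧
      IsGreatest (Phi vL vH μ0 '' {m | FeasPlus L H vL vH μ0 V m})
        (V + (1 - μ0) * vL)) ∧
    ((vH - vL)^2 / (vH + vL) < (H - L)^2 ∧ (H - L)^2 < vH - vL →
      (∀ m : Mech, IsMaximizer {m' | FeasPlus L H vL vH μ0 V m'} (PhiB vL vH μ0 β) m →
        m.xL = L - ((vH - vL) - (H - L)^2) / (2 * (H - L)) ∧ m.piL = 1 ∧
          m.piH = (1 - μ0) * vL / (μ0 * (vH - vL))) ∧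
      IsGreatest (PhiB vL vH μ0 β '' {m | FeasPlus L H vL vH μ0 V m})
        (V + (1 - μ0) * vL - (1 - μ0) * (((vH - vL) - (H - L)^2) / (2 * (H - L)))^2) ∧
      IsGreatest (Phi vL vH μ0 '' {m | FeasPlus L H vL vH μ0 V m})
        (V + (1 - μ0) * vL - (1 - μ0) * (((vH - vL) - (H - L)^2) / (2 * (H - L)))^2)) ∧
    ((H - L)^2 ≤ (vH - vL)^2 / (vH + vL) →
      (∀ m : Mech, IsMaximizer {m' | FeasPlus L H vL vH μ0 V m'} (PhiB vL vH μ0 β) m →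
        m.xL = L - (H - L) * vL / (vH - vL) ∧
          m.piL = (H - L)^2 * (vH + vL) / (vH - vL)^2 ∧
          m.piH = ((1 - μ0) * vL / (μ0 * (vH - vL))) *
            ((H - L)^2 * (vH + vL) / (vH - vL)^2)) ∧
      IsGreatest (PhiB vL vH μ0 β '' {m | FeasPlus L H vL vH μ0 V m})
        (V + (1 - μ0) * ((H - L) / (vH - vL))^2 * vL * vH) ∧
      IsGreatest (Phi vL vH μ0 '' {m | FeasPlus L H vL vH μ0 V m})
        (V + (1 - μ0) * ((H - L) / (vH - vL))^2 * vL * vH)) := by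
  have hfull {y l : ℝ} (c : DualCertificate L H vL vH μ0 y 1 l)
      (hl : l * (vH - vL) < (1 - μ0) * vL) (m : Mech)
      (hm : IsMaximizer {m' | FeasPlus L H vL vH μ0 V m'} (PhiB vL vH μ0 β) m) :
      m.xL = L - y ∧ m.piL = 1 ∧ m.piH = (1 - μ0) * vL / (μ0 * (vH - vL)) := by
    obtain ⟨-, hxL, hred, -, hpiH⟩ := c.eq_of_isMaximizer hvL hv hμ.2 hprior hβ.2 hm
    have hpiL : m.piL = 1 :=
      (sub_eq_zero.1 ((mul_eq_zero.1 hred).resolve_left (sub_pos.2 hl).ne')).symm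
    exact ⟨hxL, hpiL, by rw [hpiH, hpiL, mul_one]⟩
  have hvalue {y p l W : ℝ} (c : DualCertificate L H vL vH μ0 y p l)
      (hW : V + (1 - μ0) * (p * vL - y ^ 2) = W) :
      IsGreatest (PhiB vL vH μ0 β '' {m | FeasPlus L H vL vH μ0 V m}) W ∧
        IsGreatest (Phi vL vH μ0 '' {m | FeasPlus L H vL vH μ0 V m}) W := by
    rw [← PhiB_one, ← hW]
    exact ⟨c.isGreatest hvL hv hμ.2 hprior hβ.2.le,
      c.isGreatest hvL hv hμ.2 hprior le_rfl⟩
  have hD : 0 < vH - vL := sub_pos.2 hv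
  refine ⟨fun m hm => ?_, fun h => ?_, fun h => ?_, fun h => ?_⟩
  · rcases le_or_gt (vH - vL) ((H - L) ^ 2) with h | h
    · exact ((dualCertificate_of_large hvL hμ h).eq_of_isMaximizer
        hvL hv hμ.2 hprior hβ.2 hm).1
    rcases lt_or_ge ((vH - vL) ^ 2 / (vH + vL)) ((H - L) ^ 2) with h' | h'
    · exact ((dualCertificate_of_middle hLH hvL hv hμ.2 hprior h' h).eq_of_isMaximizer
        hvL hv hμ.2 hprior hβ.2 hm).1
    · exact ((dualCertificate_of_small hvL hv hμ.2 hprior h').eq_of_isMaximizer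
        hvL hv hμ.2 hprior hβ.2 hm).1
  · have c := dualCertificate_of_large hvL hμ h
    refine ⟨fun m hm => ?_, hvalue c (by ring)⟩
    have hl : 0 * (vH - vL) < (1 - μ0) * vL := by
      rw [zero_mul]
      exact mul_pos (sub_pos.2 hμ.2) hvL
    simpa using hfull c hl m hm
  · exact ⟨hfull (dualCertificate_of_middle hLH hvL hv hμ.2 hprior h.1 h.2)
      (middle_multiplier_lt hLH hvL hv hμ.2 h.1),
      hvalue (dualCertificate_of_middle hLH hvL hv hμ.2 hprior h.1 h.2) (by ring)⟩
  · have c := dualCertificate_of_small hvL hv hμ.2 hprior h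
    refine ⟨fun m hm => ?_, hvalue c (by field_simp; ring)⟩
    obtain ⟨-, hxL, -, hsl, hpiH⟩ := c.eq_of_isMaximizer hvL hv hμ.2 hprior hβ.2 hm
    have hl : (1 - μ0) * vL / (vH - vL) ≠ 0 :=
      (div_pos (mul_pos (sub_pos.2 hμ.2) hvL) hD).ne'
    have hpiL : m.piL = (H - L) ^ 2 * (vH + vL) / (vH - vL) ^ 2 := by
      refine mul_right_cancel₀ hD.ne' ?_
      linarith [(mul_eq_zero.1 hsl).resolve_left hl, (mul_eq_zero.1 c.slack).resolve_left hl]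
    exact ⟨hxL, hpiL, by rw [hpiH, hpiL]⟩
end

section
/- Fix reals L, H with δ := H − L > 0, reals 0 < v_L < v_H with Δv := v_H − v_L, μ0 ∈ (0,1) with μ0 < v_L/v_H, a real V, and a bargaining weight β ∈ (0,1). Define the β-objective Ψ_β(m) := μ0·f_H + (1−μ0)·f_L + β·((1−μ0)·πL·v_L − μ0·πH·Δv + μ0·v_H − v_L). Then the maximum of Ψ_β over the small-prior feasible set F⁻ equals V, and a mechanism m ∈ F⁻ is a maximizer if and only if x_H = H, x_L = L, f_H = f_L = V, and πL = πH = 1. In particular the maximum value is independent of β and equals the maximum of the β = 1 objective Ψ over F⁻. -/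
/-- The intermediary's objective with bargaining weight `β` over the data-trade
surplus, in the small-prior case. -/
noncomputable def PsiB (vL vH μ0 β : ℝ) (m : Mech) : ℝ :=
  μ0 * m.fH + (1 - μ0) * m.fL +
    β * ((1 - μ0) * m.piL * vL - μ0 * m.piH * (vH - vL) + μ0 * vH - vL)

/-- Substituting both participation constraints into the `β`-objective bounds it by `V` minus
the losses from distorted service and from withheld disclosure. -/
theorem FeasMinus.psiB_add_losses_le {L H vL vH μ0 V : ℝ} {m : Mech} (β : ℝ)
    (hμ : μ0 ∈ Set.Icc (0 : ℝ) 1) (hm : FeasMinus L H vL vH μ0 V m) :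
    PsiB vL vH μ0 β m + μ0 * (m.xH - H) ^ 2 + (1 - μ0) * (m.xL - L) ^ 2 +
      (1 - β) * (μ0 * ((1 - m.piH) * (vH - vL))) + β * ((1 - μ0) * ((1 - m.piL) * vL)) ≤ V := by
  obtain ⟨-, -, -, -, -, -, hH, hL, -⟩ := hm
  have h₁ := mul_le_mul_of_nonneg_left hH hμ.1
  have h₂ := mul_le_mul_of_nonneg_left hL (sub_nonneg.2 hμ.2)
  unfold PsiB
  linarith

/-- The `β`-objective is at most `V` on the small-prior feasible set. -/
theorem FeasMinus.psiB_le {L H vL vH μ0 V β : ℝ} {m : Mech} (hvL : 0 ≤ vL) (hv : vL ≤ vH)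
    (hμ : μ0 ∈ Set.Icc (0 : ℝ) 1) (hβ : β ∈ Set.Icc (0 : ℝ) 1)
    (hm : FeasMinus L H vL vH μ0 V m) : PsiB vL vH μ0 β m ≤ V := by
  have h := hm.psiB_add_losses_le β hμ
  have hL := sub_nonneg.2 hm.2.1
  have hH := sub_nonneg.2 hm.2.2.2.1
  have hμ' := sub_nonneg.2 hμ.2
  have hβ' := sub_nonneg.2 hβ.2
  have hv' := sub_nonneg.2 hv
  have t₁ := mul_nonneg hμ.1 (sq_nonneg (m.xH - H))
  have t₂ := mul_nonneg hμ' (sq_nonneg (m.xL - L))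
  have t₃ := mul_nonneg hβ' (mul_nonneg hμ.1 (mul_nonneg hH hv'))
  have t₄ := mul_nonneg hβ.1 (mul_nonneg hμ' (mul_nonneg hL hvL))
  linarith

/-- For interior parameters, a feasible mechanism attaining `V` provides each type's ideal service
at fee `V` and always discloses the low-price signal. -/
theorem FeasMinus.eq_of_le_psiB {L H vL vH μ0 V β : ℝ} {m : Mech} (hvL : 0 < vL) (hv : vL < vH)
    (hμ : μ0 ∈ Set.Ioo (0 : ℝ) 1) (hβ : β ∈ Set.Ioo (0 : ℝ) 1)
    (hm : FeasMinus L H vL vH μ0 V m) (hV : V ≤ PsiB vL vH μ0 β m) :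
    m = ⟨H, L, V, V, 1, 1⟩ := by
  have h := hm.psiB_add_losses_le β ⟨hμ.1.le, hμ.2.le⟩
  obtain ⟨xH, xL, fH, fL, piL, piH⟩ := m
  obtain ⟨-, hL, -, hH, -, -, hIRH, hIRL, -⟩ := hm
  dsimp only at *
  have hμ0 := hμ.1
  have hβ0 := hβ.1
  have hμ' := sub_pos.2 hμ.2
  have hβ' := sub_pos.2 hβ.2
  have hv' := sub_pos.2 hv
  have hL' := sub_nonneg.2 hL
  have hH' := sub_nonneg.2 hH
  have t₁ : 0 ≤ μ0 * (xH - H) ^ 2 := by positivity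
  have t₂ : 0 ≤ (1 - μ0) * (xL - L) ^ 2 := by positivity
  have t₃ : 0 ≤ (1 - β) * (μ0 * ((1 - piH) * (vH - vL))) := by positivity
  have t₄ : 0 ≤ β * ((1 - μ0) * ((1 - piL) * vL)) := by positivity
  have e₁ : μ0 * (xH - H) ^ 2 = 0 := by linarith
  have e₂ : (1 - μ0) * (xL - L) ^ 2 = 0 := by linarith
  have e₃ : (1 - β) * (μ0 * ((1 - piH) * (vH - vL))) = 0 := by linarith
  have e₄ : β * ((1 - μ0) * ((1 - piL) * vL)) = 0 := by linarith
  simp only [mul_eq_zero, hμ0.ne', hβ0.ne', hμ'.ne', hβ'.ne', hv'.ne', hvL.ne', false_or, or_false,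
    pow_eq_zero_iff two_ne_zero, sub_eq_zero] at e₁ e₂ e₃ e₄
  subst e₁ e₂ e₃ e₄
  have hfH : fH ≤ V := by linarith
  have hfL : fL ≤ V := by linarith
  have hsum : V ≤ μ0 * fH + (1 - μ0) * fL := by
    unfold PsiB at hV
    linarith
  have hfH' : V ≤ fH := by
    have := mul_le_mul_of_nonneg_left hfL hμ'.le
    exact le_of_mul_le_mul_left (by linarith) hμ0
  have hfL' : V ≤ fL := by
    have := mul_le_mul_of_nonneg_left hfH hμ0.le
    exact le_of_mul_le_mul_left (by linarith) hμ'
  rw [le_antisymm hfH hfH', le_antisymm hfL hfL']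

/-- Full disclosure with ideal services at fee `V` is feasible. -/
theorem feasMinus_ideal (L H vL vH μ0 V : ℝ) : FeasMinus L H vL vH μ0 V ⟨H, L, V, V, 1, 1⟩ := by
  have h := sq_nonneg (H - L)
  refine ⟨?_, ?_, ?_, ?_, ?_, ?_, ?_, ?_, ?_⟩ <;> dsimp only <;> linarith

theorem psiB_ideal (L H vL vH μ0 V β : ℝ) : PsiB vL vH μ0 β ⟨H, L, V, V, 1, 1⟩ = V := by
  unfold PsiB
  ring

theorem psiB_one (vL vH μ0 : ℝ) : PsiB vL vH μ0 1 = Psi vL vH μ0 := by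
  funext m
  unfold PsiB Psi
  ring

theorem isGreatest_psiB_image {L H vL vH μ0 V β : ℝ} (hvL : 0 ≤ vL) (hv : vL ≤ vH)
    (hμ : μ0 ∈ Set.Icc (0 : ℝ) 1) (hβ : β ∈ Set.Icc (0 : ℝ) 1) :
    IsGreatest (PsiB vL vH μ0 β '' {m | FeasMinus L H vL vH μ0 V m}) V :=
  ⟨⟨_, feasMinus_ideal L H vL vH μ0 V, psiB_ideal L H vL vH μ0 V β⟩,
    Set.forall_mem_image.2 fun _ hm => FeasMinus.psiB_le hvL hv hμ hβ hm⟩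

theorem stmt19 (L H vL vH μ0 V β : ℝ) (hLH : L < H) (hvL : 0 < vL) (hv : vL < vH)
    (hμ : μ0 ∈ Set.Ioo (0:ℝ) 1) (hprior : μ0 < vL / vH) (hβ : β ∈ Set.Ioo (0:ℝ) 1) :
    IsGreatest (PsiB vL vH μ0 β '' {m | FeasMinus L H vL vH μ0 V m}) V ∧
    (∀ m : Mech, FeasMinus L H vL vH μ0 V m →
      (IsMaximizer {m' | FeasMinus L H vL vH μ0 V m'} (PsiB vL vH μ0 β) m ↔
        (m.xH = H ∧ m.xL = L ∧ m.fH = V ∧ m.fL = V ∧ m.piL = 1 ∧ m.piH = 1))) ∧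
    IsGreatest (Psi vL vH μ0 '' {m | FeasMinus L H vL vH μ0 V m}) V := by
  have hμ' := Set.Ioo_subset_Icc_self hμ
  have hβ' := Set.Ioo_subset_Icc_self hβ
  refine ⟨isGreatest_psiB_image hvL.le hv.le hμ' hβ', fun m hm => ⟨fun hmax => ?_, ?_⟩, ?_⟩
  · have hV := hmax.2 _ (feasMinus_ideal L H vL vH μ0 V)
    rw [psiB_ideal] at hV
    rw [hm.eq_of_le_psiB hvL hv hμ hβ hV]
    exact ⟨rfl, rfl, rfl, rfl, rfl, rfl⟩
  · obtain ⟨xH, xL, fH, fL, piL, piH⟩ := m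
    rintro ⟨rfl, rfl, rfl, h, rfl, rfl⟩
    dsimp only at h
    subst h
    refine ⟨hm, fun m' hm' => ?_⟩
    rw [psiB_ideal]
    exact FeasMinus.psiB_le hvL.le hv.le hμ' hβ' hm'
  · rw [← psiB_one]
    exact isGreatest_psiB_image hvL.le hv.le hμ' ⟨zero_le_one, le_rfl⟩
end
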